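/- arXiv:1307.2388 — 2 statements merged into one kernel-verified Lean document; each statement's English description precedes it below -/
import Mathlib

section
/- Let K be a real differential field whose field of constants k is real closed, with k ≠ K, let A ∈ Mat_n(K), and let L₁, L₂ be two real Picard–Vessiot fields for y′ = Ay over K. Suppose L₁ and L₂ admit orderings which induce the same ordering on K. Then there exists a K-linear isomorphism φ : L₁ → L₂ of differential fields. -/
/-- A derivation on a field `F`. -/
structure FieldDeriv (F : Type) [Field F] : Type where
  d : F → F
  map_add : ∀ a b : F, d (a + b) = d a + d b
  leibniz : ∀ a b : F, d (a * b) = a * d b + d a * b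

/-- A field is (formally) real if `-1` is not a sum of squares. -/
def IsFormallyRealField (F : Type) [Field F] : Prop :=
  ¬ IsSumSq (-1 : F)

/-- A field is real closed if it is real and no proper algebraic extension of it is real. -/
def IsRealClosedField (F : Type) [Field F] : Prop :=
  IsFormallyRealField F ∧
    ∀ (E : Type) [Field E] [Algebra F E], Algebra.IsAlgebraic F E →
      IsFormallyRealField E → Function.Surjective (algebraMap F E)

/-- An ordering of a field `F`, given by its positive cone `P` (the set of nonnegative
elements): `P` is closed under addition and multiplication, every element or its negative
lies in `P`, and `-1 ∉ P`.  This is equivalent to a linear order making `F` an ordered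
field. -/
structure FieldOrdering (F : Type) [Field F] : Type where
  P : Set F
  add_mem : ∀ x ∈ P, ∀ y ∈ P, x + y ∈ P
  mul_mem : ∀ x ∈ P, ∀ y ∈ P, x * y ∈ P
  total : ∀ x : F, x ∈ P ∨ -x ∈ P
  neg_one_not_mem : (-1 : F) ∉ P

/-- `L/K`, with derivations `dL` extending `dK`, is a Picard--Vessiot field for `y' = A y`. -/
def IsPicardVessiot {K L : Type} [Field K] [Field L] [Algebra K L]
    (dK : FieldDeriv K) (dL : FieldDeriv L) {n : ℕ}
    (A : Matrix (Fin n) (Fin n) K) : Prop :=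
  (∀ a : K, dL.d (algebraMap K L a) = algebraMap K L (dK.d a)) ∧
  ∃ F : Matrix (Fin n) (Fin n) L, IsUnit F.det ∧
    (∀ i j, dL.d (F i j) = (A.map (algebraMap K L) * F) i j) ∧
    IntermediateField.adjoin K (Set.range fun q : Fin n × Fin n => F q.1 q.2) = ⊤ ∧
    ∀ x : L, dL.d x = 0 → ∃ a : K, dK.d a = 0 ∧ algebraMap K L a = x

section

open Polynomial

/-- The finite sums of elements `p * e ^ 2` with `p ∈ P`. -/
def weightedSumSq {R : Type*} [CommRing R] (P : Submonoid R) : AddSubmonoid R :=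
  AddSubmonoid.closure {x | ∃ p ∈ P, ∃ e : R, x = p * e ^ 2}

namespace weightedSumSq

variable {R S : Type*} [CommRing R] [CommRing S] {P : Submonoid R}

theorem mem_of_mem {p : R} (hp : p ∈ P) (e : R) : p * e ^ 2 ∈ weightedSumSq P :=
  AddSubmonoid.subset_closure ⟨p, hp, e, rfl⟩

theorem sq_mem (e : R) : e ^ 2 ∈ weightedSumSq P := by
  simpa using mem_of_mem P.one_mem e

theorem mul_mem {x y : R} (hx : x ∈ weightedSumSq P) (hy : y ∈ weightedSumSq P) :
    x * y ∈ weightedSumSq P := by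
  induction hx using AddSubmonoid.closure_induction with
  | zero => simp
  | add a b _ _ ha hb => rw [add_mul]; exact add_mem ha hb
  | mem x hx =>
    obtain ⟨p, hp, e, rfl⟩ := hx
    induction hy using AddSubmonoid.closure_induction with
    | zero => simp
    | add a b _ _ ha hb => rw [mul_add]; exact add_mem ha hb
    | mem y hy =>
      obtain ⟨q, hq, f, rfl⟩ := hy
      have := mem_of_mem (P.mul_mem hp hq) (e * f)
      convert this using 1
      ring

theorem map_mem (f : R →+* S) {x : R} (hx : x ∈ weightedSumSq P) :
    f x ∈ weightedSumSq (P.map f) := by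
  induction hx using AddSubmonoid.closure_induction with
  | zero => simp
  | add a b _ _ ha hb => rw [map_add]; exact add_mem ha hb
  | mem x hx =>
    obtain ⟨p, hp, e, rfl⟩ := hx
    rw [map_mul, map_pow]
    exact mem_of_mem (Submonoid.mem_map_of_mem f hp) _

theorem exists_of_surjective (f : R →+* S) (hf : Function.Surjective f) {y : S}
    (hy : y ∈ weightedSumSq (P.map f)) : ∃ x ∈ weightedSumSq P, f x = y := by
  induction hy using AddSubmonoid.closure_induction with
  | zero => exact ⟨0, zero_mem _, map_zero f⟩
  | add a b _ _ ha hb =>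
    obtain ⟨x, hx, rfl⟩ := ha
    obtain ⟨y, hy, rfl⟩ := hb
    exact ⟨x + y, add_mem hx hy, map_add f x y⟩
  | mem y hy =>
    obtain ⟨_, ⟨p, hp, rfl⟩, e, rfl⟩ := hy
    obtain ⟨e, rfl⟩ := hf e
    exact ⟨p * e ^ 2, mem_of_mem hp e, by simp⟩

variable {F : Type*} [Field F] {Q : Submonoid F}

theorem inv_mem {x : F} (hx : x ∈ weightedSumSq Q) : x⁻¹ ∈ weightedSumSq Q := by
  rcases eq_or_ne x 0 with rfl | h
  · simp
  · have := mul_mem hx (sq_mem (P := Q) x⁻¹)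
    convert this using 1
    field_simp

theorem eq_zero_of_neg_mem (hQ : (-1 : F) ∉ weightedSumSq Q) {x : F}
    (hx : x ∈ weightedSumSq Q) (hx' : -x ∈ weightedSumSq Q) : x = 0 := by
  by_contra h
  apply hQ
  have := mul_mem hx' (inv_mem hx)
  convert this using 1
  field_simp

theorem leadingCoeff_mem_and_even (hQ : (-1 : F) ∉ weightedSumSq Q) {s : F[X]}
    (hs : s ∈ weightedSumSq (Q.map (C : F →+* F[X]))) :
    s.leadingCoeff ∈ weightedSumSq Q ∧ Even s.natDegree := by
  induction hs using AddSubmonoid.closure_induction with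
  | zero => simp
  | mem s hs =>
    obtain ⟨_, ⟨p, hp, rfl⟩, e, rfl⟩ := hs
    refine ⟨by simpa using mem_of_mem hp _, ?_⟩
    rcases eq_or_ne p 0 with rfl | h
    · simp
    · rw [natDegree_C_mul h, natDegree_pow]
      exact even_two_mul _
  | add a b _ _ ha hb =>
    rcases lt_trichotomy a.degree b.degree with h | h | h
    · rw [leadingCoeff_add_of_degree_lt h, natDegree_add_eq_right_of_degree_lt h]
      exact hb
    · by_cases h0 : a.leadingCoeff + b.leadingCoeff = 0
      · have h1 := eq_zero_of_neg_mem hQ ha.1 (by rw [neg_eq_of_add_eq_zero_right h0]; exact hb.1)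
        rw [leadingCoeff_eq_zero] at h1
        subst h1
        simpa using hb
      · rw [leadingCoeff_add_of_degree_eq h h0]
        refine ⟨add_mem ha.1 hb.1, ?_⟩
        have h1 : (a + b).degree = a.degree := by
          rw [degree_add_eq_of_leadingCoeff_add_ne_zero h0, h, max_self]
        rw [natDegree_eq_of_degree_eq h1]
        exact ha.2
    · rw [leadingCoeff_add_of_degree_lt' h, natDegree_add_eq_left_of_degree_lt h]
      exact ha

theorem exists_mod_degree_le {f s : F[X]} {n : ℕ} (hn : f.natDegree = n + 1)
    (hs : s ∈ weightedSumSq (Q.map (C : F →+* F[X]))) :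
    ∃ t ∈ weightedSumSq (Q.map (C : F →+* F[X])), t.natDegree ≤ 2 * n ∧ f ∣ s - t := by
  induction hs using AddSubmonoid.closure_induction with
  | zero => exact ⟨0, zero_mem _, by simp⟩
  | add a b _ _ ha hb =>
    obtain ⟨t, ht, ht', ht''⟩ := ha
    obtain ⟨u, hu, hu', hu''⟩ := hb
    refine ⟨t + u, add_mem ht hu, (natDegree_add_le _ _).trans (max_le ht' hu'), ?_⟩
    convert dvd_add ht'' hu'' using 1
    ring
  | mem s hs =>
    obtain ⟨_, ⟨p, hp, rfl⟩, e, rfl⟩ := hs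
    refine ⟨C p * (e % f) ^ 2, mem_of_mem (Submonoid.mem_map_of_mem C hp) _, ?_, ?_⟩
    · have h1 : (e % f).natDegree ≤ n :=
        Nat.lt_succ_iff.mp ((natDegree_mod_lt e (by lia)).trans_eq hn)
      refine (natDegree_C_mul_le _ _).trans (natDegree_pow_le.trans ?_)
      lia
    · have h1 : e = f * (e / f) + e % f := (EuclideanDomain.div_add_mod e f).symm
      have h2 : f ∣ e - e % f := ⟨e / f, by linear_combination h1⟩
      have : (C : F →+* F[X]) p * e ^ 2 - C p * (e % f) ^ 2
          = (e - e % f) * (C p * (e + e % f)) := by ring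
      rw [this]
      exact h2.mul_right _

theorem not_dvd_of_odd (hQ : (-1 : F) ∉ weightedSumSq Q) {f s : F[X]}
    (hf : Odd f.natDegree) (hs : s ∈ weightedSumSq (Q.map (C : F →+* F[X]))) :
    ¬ f ∣ 1 + s := by
  induction hm : f.natDegree using Nat.strong_induction_on generalizing f s with
  | _ m ih =>
    intro hd
    obtain ⟨n, hn⟩ : ∃ n, f.natDegree = n + 1 := Nat.exists_eq_succ_of_ne_zero (by grind)
    obtain ⟨t, ht, htd, hft⟩ := exists_mod_degree_le hn hs
    obtain ⟨h, hh⟩ : f ∣ 1 + t := by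
      convert dvd_sub hd hft using 1
      ring
    have h1t : 1 + t ∈ weightedSumSq (Q.map (C : F →+* F[X])) :=
      add_mem (by simpa using sq_mem (P := Q.map (C : F →+* F[X])) 1) ht
    have h1 := leadingCoeff_mem_and_even hQ h1t
    have h0 : 1 + t ≠ 0 := by
      intro h0
      have h2 := leadingCoeff_mem_and_even hQ ht
      rw [← neg_eq_of_add_eq_zero_right h0] at h2
      simp at h2
      exact hQ h2
    have hf0 : f ≠ 0 := by rintro rfl; simp at hf
    have hh0 : h ≠ 0 := by rintro rfl; simp [h0] at hh
    have hdeg : (1 + t).natDegree = f.natDegree + h.natDegree := by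
      rw [hh, natDegree_mul hf0 hh0]
    have hdle : (1 + t).natDegree ≤ 2 * n := by
      refine (natDegree_add_le _ _).trans ?_
      simpa using htd
    refine ih h.natDegree (by lia) ?_ ht rfl ⟨f, by rw [hh, mul_comm]⟩
    grind

/-- A field in which `-1` is not a `P`-weighted sum of squares, and all of whose proper simple
algebraic extensions fail to have this property, is real closed. -/
theorem isRealClosed (hQ : (-1 : F) ∉ weightedSumSq Q)
    (hmax : ∀ g : F[X], Irreducible g →
      (-1 : AdjoinRoot g) ∉ weightedSumSq (Q.map (AdjoinRoot.of g)) → ∃ x, g.IsRoot x) :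
    IsRealClosed F ∧ ∀ p ∈ Q, IsSquare p := by
  have key : ∀ a : F, IsSquare a ∨ -a ∈ weightedSumSq Q := by
    intro a
    by_contra! h
    obtain ⟨ha, hna⟩ := h
    have hroot : ¬ ∃ x, (X ^ 2 - C a : F[X]).IsRoot x := by
      rintro ⟨x, hx⟩
      exact ha ⟨x, by simp [IsRoot] at hx; linear_combination - hx⟩
    have hdeg : (X ^ 2 - C a : F[X]).natDegree = 2 := natDegree_X_pow_sub_C
    have hirr : Irreducible (X ^ 2 - C a : F[X]) := by
      refine (irreducible_iff_roots_eq_zero_of_degree_le_three (by lia) (by lia)).2 ?_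
      rw [Multiset.eq_zero_iff_forall_notMem]
      exact fun x hx ↦ hroot ⟨x, isRoot_of_mem_roots hx⟩
    refine hroot (hmax _ hirr fun hmem ↦ ?_)
    have hdec : ∀ z ∈ weightedSumSq (Q.map (AdjoinRoot.of (X ^ 2 - C a))),
        ∃ u ∈ weightedSumSq Q, ∃ v ∈ weightedSumSq Q, ∃ w : F,
          z = AdjoinRoot.mk _ (C (u + a * v) + C w * X) := by
      intro z hz
      induction hz using AddSubmonoid.closure_induction with
      | zero => exact ⟨0, zero_mem _, 0, zero_mem _, 0, by simp⟩
      | add x y _ _ hx hy =>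
        obtain ⟨u, hu, v, hv, w, rfl⟩ := hx
        obtain ⟨u', hu', v', hv', w', rfl⟩ := hy
        refine ⟨u + u', add_mem hu hu', v + v', add_mem hv hv', w + w', ?_⟩
        rw [← map_add]
        congr 1
        simp only [map_add, map_mul]
        ring
      | mem z hz =>
        obtain ⟨_, ⟨p, hp, rfl⟩, e, rfl⟩ := hz
        obtain ⟨e, rfl⟩ := AdjoinRoot.mk_surjective e
        have hmod : AdjoinRoot.mk (X ^ 2 - C a) e = AdjoinRoot.mk _ (e % (X ^ 2 - C a)) := by
          rw [AdjoinRoot.mk_eq_mk]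
          exact ⟨e / (X ^ 2 - C a), by
            linear_combination - EuclideanDomain.div_add_mod e (X ^ 2 - C a)⟩
        have hlin : (e % (X ^ 2 - C a)).natDegree ≤ 1 := by
          have := natDegree_mod_lt e (q := X ^ 2 - C a) (by lia)
          lia
        obtain ⟨c, b, hcb⟩ := exists_eq_X_add_C_of_natDegree_le_one hlin
        refine ⟨p * b ^ 2, mem_of_mem hp _, p * c ^ 2, mem_of_mem hp _, 2 * p * b * c, ?_⟩
        rw [hmod, hcb, ← AdjoinRoot.mk_C, ← map_pow, ← map_mul, AdjoinRoot.mk_eq_mk]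
        refine ⟨C p * C c ^ 2, ?_⟩
        simp only [map_add, map_mul, map_pow, map_ofNat]
        ring
    obtain ⟨u, hu, v, hv, w, huvw⟩ := hdec _ hmem
    have h0 : AdjoinRoot.mk (X ^ 2 - C a) (C w * X + C (u + a * v + 1)) = 0 := by
      have : (-1 : AdjoinRoot (X ^ 2 - C a)) = AdjoinRoot.mk _ (-1) := by simp
      rw [this] at huvw
      rw [← sub_eq_zero, ← map_sub] at huvw
      rw [← neg_eq_zero, ← map_neg, ← huvw]
      congr 1
      simp only [map_add, map_one]
      ring
    rw [AdjoinRoot.mk_eq_zero] at h0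
    have h1 : C w * X + C (u + a * v + 1) = 0 := by
      refine eq_zero_of_dvd_of_natDegree_lt h0 ?_
      rw [hdeg]
      exact lt_of_le_of_lt natDegree_linear_le one_lt_two
    have h2 : u + a * v + 1 = 0 := by
      have := congrArg (fun q ↦ coeff q 0) h1
      simpa using this
    have hv0 : v ≠ 0 := by
      rintro rfl
      refine hQ ?_
      convert hu using 1
      linear_combination - h2
    apply hna
    have : -a = (1 ^ 2 + u) * v⁻¹ := by
      field_simp
      linear_combination - h2
    rw [this]
    exact mul_mem (add_mem (sq_mem 1) hu) (inv_mem hv)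
  have hsq : ∀ a ∈ weightedSumSq Q, IsSquare a := by
    intro a ha
    rcases key a with h | h
    · exact h
    · rw [eq_zero_of_neg_mem hQ ha h]
      exact ⟨0, by simp⟩
  have hsum : ∀ a : F, IsSumSq a → a ∈ weightedSumSq Q := by
    intro a ha
    induction ha with
    | zero => exact zero_mem _
    | sq_add b _ ih => exact add_mem (by rw [← sq]; exact sq_mem b) ih
  have hsemi : IsSemireal F := IsSemireal.of_not_isSumSq_neg_one fun h ↦ hQ (hsum _ h)
  refine ⟨⟨fun a ↦ (key a).imp_right (hsq _), ?_⟩,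
    fun p hp ↦ hsq p (by simpa using mem_of_mem hp 1)⟩
  intro f hf
  have hodd : ∃ g : F[X], Irreducible g ∧ Odd g.natDegree ∧ g ∣ f := by
    have hf0 : f ≠ 0 := by rintro rfl; simp at hf
    induction hm : f.natDegree using Nat.strong_induction_on generalizing f with
    | _ m ih =>
      have hu : ¬ IsUnit f := fun h ↦ by
        rw [natDegree_eq_zero_of_isUnit h] at hf
        simp at hf
      obtain ⟨g, hg, h, rfl⟩ := WfDvdMonoid.exists_irreducible_factor hu hf0
      rw [mul_ne_zero_iff] at hf0
      rw [natDegree_mul hf0.1 hf0.2] at hf hm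
      by_cases hgo : Odd g.natDegree
      · exact ⟨g, hg, hgo, dvd_mul_right _ _⟩
      · have := hg.natDegree_pos
        obtain ⟨g', h1, h2, h3⟩ := ih h.natDegree (by lia) (by grind) hf0.2 rfl
        exact ⟨g', h1, h2, h3.mul_left _⟩
  obtain ⟨g, hg, hgo, hgf⟩ := hodd
  obtain ⟨x, hx⟩ := hmax g hg fun hmem ↦ by
    have : Q.map (AdjoinRoot.of g) = (Q.map (C : F →+* F[X])).map (AdjoinRoot.mk g) := by
      refine SetLike.coe_injective ?_
      simp only [Submonoid.coe_map, Set.image_image]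
      rfl
    rw [this] at hmem
    obtain ⟨s, hs, hs'⟩ := exists_of_surjective _ AdjoinRoot.mk_surjective hmem
    refine not_dvd_of_odd hQ hgo hs ?_
    rw [← AdjoinRoot.mk_eq_zero, map_add, hs']
    simp
  exact ⟨x, hx.dvd hgf⟩

end weightedSumSq

theorem FieldOrdering.exists_linearOrder {F : Type} [Field F] (τ : FieldOrdering F) :
    ∃ _ : LinearOrder F, IsStrictOrderedRing F ∧ ∀ x : F, 0 ≤ x ↔ x ∈ τ.P := by
  classical
  have hsq : ∀ x, x * x ∈ τ.P := fun x ↦ by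
    rcases τ.total x with h | h
    · exact τ.mul_mem _ h _ h
    · simpa using τ.mul_mem _ h _ h
  have h0 : ∀ x ∈ τ.P, -x ∈ τ.P → x = 0 := by
    intro x hx hx'
    by_contra h
    apply τ.neg_one_not_mem
    have := τ.mul_mem _ (τ.mul_mem _ hx _ hx') _ (hsq x⁻¹)
    convert this using 1
    field_simp
  let o : LinearOrder F :=
    { le := fun x y ↦ y - x ∈ τ.P
      le_refl := fun x ↦ by simpa using hsq 0
      le_trans := fun x y z h h' ↦ by simpa using τ.add_mem _ h' _ h
      le_antisymm := fun x y h h' ↦ by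
        have := h0 _ h (by simpa using h')
        exact (sub_eq_zero.mp this).symm
      le_total := fun x y ↦ by simpa using τ.total (y - x)
      toDecidableLE := Classical.decRel _ }
  have hle : ∀ x y : F, x ≤ y ↔ y - x ∈ τ.P := fun _ _ ↦ Iff.rfl
  have : IsOrderedAddMonoid F :=
    { add_le_add_left := fun a b h c ↦ by rw [hle] at h ⊢; simpa using h }
  have : ZeroLEOneClass F := ⟨by rw [hle]; simpa using hsq 1⟩
  refine ⟨o, IsStrictOrderedRing.of_mul_pos fun a b ha hb ↦ ?_, fun x ↦ by simp [hle]⟩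
  refine lt_of_le_of_ne ?_ (mul_ne_zero ha.ne' hb.ne').symm
  rw [hle]
  simpa using τ.mul_mem _ ((hle _ _).1 ha.le) _ ((hle _ _).1 hb.le)

theorem IsRealClosed.exists_linearOrder (F : Type) [Field F] [IsRealClosed F] :
    ∃ _ : LinearOrder F, IsStrictOrderedRing F := by
  have hadd : ∀ x y : F, IsSquare x → IsSquare y → IsSquare (x + y) := by
    intro x y hx hy
    rcases isSquare_or_isSquare_neg (x + y) with h | h
    · exact h
    · by_contra hn
      have hne : -(x + y) ≠ 0 := fun h0 ↦ hn ⟨0, by simpa using neg_eq_zero.1 h0⟩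
      refine IsSemireal.not_isSumSq_neg_one F ?_
      have : (-1 : F) = (x + y) * (-(x + y))⁻¹ := by
        rw [eq_mul_inv_iff_mul_eq₀ hne]
        ring
      rw [this, add_mul]
      exact (hx.mul h.inv).isSumSq.add (hy.mul h.inv).isSumSq
  let τ : FieldOrdering F :=
    { P := {x | IsSquare x}
      add_mem := fun x hx y hy ↦ hadd x y hx hy
      mul_mem := fun x hx y hy ↦ IsSquare.mul hx hy
      total := isSquare_or_isSquare_neg
      neg_one_not_mem := fun h ↦ IsSemireal.not_isSumSq_neg_one F (IsSquare.isSumSq h) }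
  obtain ⟨o, h, -⟩ := τ.exists_linearOrder
  exact ⟨o, h⟩

theorem weightedSumSq_bot {R : Type*} [CommRing R] {x : R}
    (hx : x ∈ weightedSumSq (⊥ : Submonoid R)) : IsSumSq x := by
  induction hx using AddSubmonoid.closure_induction with
  | zero => exact IsSumSq.zero
  | add a b _ _ ha hb => exact ha.add hb
  | mem x hx =>
    obtain ⟨p, hp, e, rfl⟩ := hx
    rw [Submonoid.mem_bot.1 hp, one_mul, sq]
    exact IsSumSq.mul_self e

theorem IsRealClosedField.isRealClosed {F : Type} [Field F] (h : IsRealClosedField F) :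
    IsRealClosed F := by
  refine (weightedSumSq.isRealClosed (Q := ⊥) (fun h1 ↦ h.1 (weightedSumSq_bot h1)) ?_).1
  intro g hg hmem
  have : Fact (Irreducible g) := ⟨hg⟩
  have hfin : Module.Finite F (AdjoinRoot g) := (AdjoinRoot.powerBasis hg.ne_zero).finite
  obtain ⟨x, hx⟩ := h.2 (AdjoinRoot g) (Algebra.IsAlgebraic.of_finite _ _)
    (fun h1 ↦ hmem (by
      generalize (-1 : AdjoinRoot g) = y at h1
      induction h1 with
      | zero => exact zero_mem _
      | sq_add b _ ih => exact add_mem (by rw [← sq]; exact weightedSumSq.sq_mem b) ih))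
    (AdjoinRoot.root g)
  refine ⟨x, ?_⟩
  have h2 := AdjoinRoot.eval₂_root g
  rw [← hx, AdjoinRoot.algebraMap_eq, eval₂_at_apply] at h2
  exact (map_eq_zero _).1 h2

/-- Every ordered field has an ordered extension which is real closed. -/
theorem exists_isRealClosed_extension (F : Type) [Field F] [LinearOrder F]
    [IsStrictOrderedRing F] :
    ∃ (M : Type) (_ : Field M) (_ : LinearOrder M) (_ : IsStrictOrderedRing M)
      (_ : IsRealClosed M) (f : F →+* M), ∀ x, 0 ≤ x → 0 ≤ f x := by
  let P : Submonoid F :=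
    { carrier := {x | 0 ≤ x}
      one_mem' := zero_le_one
      mul_mem' := fun ha hb ↦ mul_nonneg ha hb }
  let Ω := AlgebraicClosure F
  have hcoe : ∀ (M : IntermediateField F Ω) (x : M), x ∈ weightedSumSq (P.map (algebraMap F M)) →
      (x : Ω) ∈ AddSubmonoid.closure {x | ∃ p ∈ P, ∃ e ∈ M, x = algebraMap F Ω p * e ^ 2} := by
    intro M x hx
    induction hx using AddSubmonoid.closure_induction with
    | zero => exact zero_mem _
    | add a b _ _ ha hb => exact add_mem ha hb
    | mem x hx =>
      obtain ⟨_, ⟨p, hp, rfl⟩, e, rfl⟩ := hx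
      exact AddSubmonoid.subset_closure ⟨p, hp, e, e.2, rfl⟩
  let S : Set (IntermediateField F Ω) := {M | (-1 : M) ∉ weightedSumSq (P.map (algebraMap F M))}
  have hchain : ∀ c ⊆ S, IsChain (· ≤ ·) c → ∀ y ∈ c, ∃ ub ∈ S, ∀ z ∈ c, z ≤ ub := by
    intro c hc hchain y hy
    have hdir : DirectedOn (· ≤ ·) c := hchain.directedOn
    have : Nonempty c := ⟨⟨y, hy⟩⟩
    refine ⟨sSup c, fun hmem ↦ ?_, fun z hz ↦ le_sSup hz⟩
    have key : ∀ x : Ω, x ∈ AddSubmonoid.closure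
        {x | ∃ p ∈ P, ∃ e ∈ sSup c, x = algebraMap F Ω p * e ^ 2} →
        ∃ M ∈ c, ∃ z ∈ weightedSumSq (P.map (algebraMap F M)), (z : Ω) = x := by
      intro x hx
      induction hx using AddSubmonoid.closure_induction with
      | zero => exact ⟨y, hy, 0, zero_mem _, rfl⟩
      | add a b _ _ ha hb =>
        obtain ⟨M, hM, z, hz, rfl⟩ := ha
        obtain ⟨N, hN, w, hw, rfl⟩ := hb
        obtain ⟨R, hR, h1, h2⟩ := hdir M hM N hN
        have e1 := weightedSumSq.map_mem (IntermediateField.inclusion h1).toRingHom hz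
        have e2 := weightedSumSq.map_mem (IntermediateField.inclusion h2).toRingHom hw
        rw [show (P.map (algebraMap F M)).map (IntermediateField.inclusion h1).toRingHom =
          P.map (algebraMap F R) from SetLike.coe_injective (by
            simp only [Submonoid.coe_map, Set.image_image]; rfl)] at e1
        rw [show (P.map (algebraMap F N)).map (IntermediateField.inclusion h2).toRingHom =
          P.map (algebraMap F R) from SetLike.coe_injective (by
            simp only [Submonoid.coe_map, Set.image_image]; rfl)] at e2
        exact ⟨R, hR, _, add_mem e1 e2, rfl⟩
      | mem x hx =>
        obtain ⟨p, hp, e, he, rfl⟩ := hx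
        rw [sSup_eq_iSup', ← SetLike.mem_coe,
          IntermediateField.coe_iSup_of_directed hdir.directed_val] at he
        obtain ⟨M, he⟩ := Set.mem_iUnion.1 he
        exact ⟨M, M.2, _, weightedSumSq.mem_of_mem (Submonoid.mem_map_of_mem _ hp) ⟨e, he⟩, rfl⟩
    obtain ⟨M, hM, z, hz, hz'⟩ := key _ (hcoe _ _ hmem)
    refine hc hM ?_
    convert hz
    exact Subtype.ext hz'.symm
  have hbot : (⊥ : IntermediateField F Ω) ∈ S := by
    intro hmem
    have hpos : ∀ x : (⊥ : IntermediateField F Ω), x ∈ weightedSumSq (P.map (algebraMap F _)) →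
        0 ≤ IntermediateField.botEquiv F Ω x := by
      intro x hx
      induction hx using AddSubmonoid.closure_induction with
      | zero => simp
      | add a b _ _ ha hb => rw [map_add]; exact add_nonneg ha hb
      | mem x hx =>
        obtain ⟨_, ⟨p, hp, rfl⟩, e, rfl⟩ := hx
        rw [map_mul, AlgEquiv.commutes, map_pow]
        exact mul_nonneg hp (sq_nonneg _)
    have := hpos _ hmem
    rw [map_neg, map_one] at this
    linarith
  obtain ⟨M, -, hM⟩ := zorn_le_nonempty₀ S hchain ⊥ hbot
  have hRC : IsRealClosed M ∧ ∀ p ∈ P.map (algebraMap F M), IsSquare p := by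
    refine weightedSumSq.isRealClosed hM.prop ?_
    intro g hg hmem
    have : Fact (Irreducible g) := ⟨hg⟩
    obtain ⟨α, hα⟩ := IsAlgClosed.exists_aeval_eq_zero Ω g hg.degree_pos.ne'
    let φ : AdjoinRoot g →ₐ[M] Ω := AdjoinRoot.liftAlgHom g (Algebra.ofId M Ω) α hα
    let N : IntermediateField F Ω := (φ.restrictScalars F).fieldRange
    have hMN : M ≤ N := fun x hx ↦ ⟨algebraMap M _ ⟨x, hx⟩, by
      change φ _ = _
      rw [φ.commutes]
      rfl⟩
    have hNS : N ∈ S := by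
      intro hN
      let e : AdjoinRoot g ≃ₐ[F] N := AlgEquiv.ofInjectiveField (φ.restrictScalars F)
      have h1 := weightedSumSq.map_mem e.symm.toRingHom hN
      apply hmem
      have h2 : (P.map (algebraMap F N)).map e.symm.toRingHom =
          (P.map (algebraMap F M)).map (AdjoinRoot.of g) := by
        refine SetLike.coe_injective ?_
        simp only [Submonoid.coe_map, Set.image_image]
        exact Set.image_congr fun p _ ↦ e.symm.commutes p
      rw [h2, map_neg, map_one] at h1
      exact h1
    have hαM : α ∈ M := hM.le_of_ge hNS hMN ⟨AdjoinRoot.root g, by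
      change φ _ = _
      exact AdjoinRoot.liftAlgHom_root ..⟩
    refine ⟨⟨α, hαM⟩, ?_⟩
    rw [aeval_def, show α = algebraMap M Ω ⟨α, hαM⟩ from rfl, eval₂_at_apply] at hα
    exact (map_eq_zero _).1 hα
  have := hRC.1
  obtain ⟨o, ho⟩ := IsRealClosed.exists_linearOrder M
  exact ⟨M, inferInstance, o, ho, hRC.1, algebraMap F M, fun x hx ↦
    (hRC.2 _ (Submonoid.mem_map_of_mem _ hx)).nonneg⟩

theorem finrank_ne_two_of_forall_isSquare {F E : Type*} [Field F] [CharZero F] [Field E]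
    [Algebra F E] (h : ∀ x : F, IsSquare x) : Module.finrank F E ≠ 2 := by
  intro h2
  have : FiniteDimensional F E := Module.finite_of_finrank_pos (by lia)
  obtain ⟨α, hα⟩ : ∃ α : E, α ∉ (⊥ : Subalgebra F E) := by
    by_contra! hall
    have : (⊥ : Subalgebra F E) = ⊤ := by
      rw [eq_top_iff]
      exact fun x _ ↦ hall x
    have := Subalgebra.bot_eq_top_iff_finrank_eq_one.1 this
    lia
  have hint : IsIntegral F α := Algebra.IsIntegral.isIntegral α
  have hirr := minpoly.irreducible hint
  have hdeg : (minpoly F α).natDegree ≤ 2 := h2 ▸ minpoly.natDegree_le α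
  have hdeg' : (minpoly F α).natDegree ≠ 1 := fun h1 ↦ hα (by
    rw [Algebra.mem_bot]
    exact minpoly.natDegree_eq_one_iff.1 h1)
  have hpos := hirr.natDegree_pos
  have hdeg2 : (minpoly F α).natDegree = 2 := by lia
  have hmon : (minpoly F α).coeff 2 = 1 := by
    rw [← hdeg2]
    exact minpoly.monic hint
  obtain ⟨s, hs⟩ := h (discrim 1 ((minpoly F α).coeff 1) ((minpoly F α).coeff 0))
  obtain ⟨x, hx⟩ := exists_quadratic_eq_zero one_ne_zero ⟨s, hs⟩
  have hroot : (minpoly F α).IsRoot x := by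
    rw [IsRoot, eval_eq_sum_range, hdeg2]
    simp [Finset.sum_range_succ, hmon]
    linear_combination hx
  exact hdeg' (natDegree_eq_of_degree_eq_some (degree_eq_one_of_irreducible_of_root hirr hroot))

theorem IsRealClosed.finrank_eq_one_of_odd {M N : Type*} [Field M] [IsRealClosed M]
    [CharZero M] [Field N] [Algebra M N] (h : Odd (Module.finrank M N)) :
    Module.finrank M N = 1 := by
  have : FiniteDimensional M N := Module.finite_of_finrank_pos h.pos
  obtain ⟨α, hα⟩ := Field.exists_primitive_element M N
  have hint : IsIntegral M α := Algebra.IsIntegral.isIntegral α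
  have hdeg : (minpoly M α).natDegree = Module.finrank M N := by
    rw [← IntermediateField.adjoin.finrank hint, hα, IntermediateField.finrank_top']
  obtain ⟨x, hx⟩ := exists_isRoot_of_odd_natDegree (f := minpoly M α) (hdeg ▸ h)
  rw [← hdeg]
  exact natDegree_eq_of_degree_eq_some
    (degree_eq_one_of_irreducible_of_root (minpoly.irreducible hint) hx)

section

variable {M : Type*} [Field M] [LinearOrder M] [IsStrictOrderedRing M]
  {N : Type*} [Field N] [Algebra M N] {i : N}

theorem IsRealClosed.exists_add_mul_of_mem_adjoin (hi : i ^ 2 = -1) {z : N}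
    (hz : z ∈ IntermediateField.adjoin M {i}) :
    ∃ a b : M, z = algebraMap M N a + algebraMap M N b * i := by
  induction hz using IntermediateField.adjoin_induction with
  | mem x hx => exact ⟨0, 1, by simpa using hx⟩
  | algebraMap x => exact ⟨x, 0, by simp⟩
  | add x y _ _ hx hy =>
    obtain ⟨a, b, rfl⟩ := hx
    obtain ⟨c, d, rfl⟩ := hy
    exact ⟨a + c, b + d, by simp only [map_add]; ring⟩
  | mul x y _ _ hx hy =>
    obtain ⟨a, b, rfl⟩ := hx
    obtain ⟨c, d, rfl⟩ := hy
    exact ⟨a * c - b * d, a * d + b * c, by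
      simp only [map_add, map_mul, map_sub]
      linear_combination (algebraMap M N b * algebraMap M N d) * hi⟩
  | inv x _ hx =>
    obtain ⟨a, b, rfl⟩ := hx
    by_cases h0 : a ^ 2 + b ^ 2 = 0
    · have ha : a = 0 := by nlinarith [sq_nonneg a, sq_nonneg b]
      have hb : b = 0 := by nlinarith [sq_nonneg a, sq_nonneg b]
      exact ⟨0, 0, by simp [ha, hb]⟩
    · refine ⟨a / (a ^ 2 + b ^ 2), -b / (a ^ 2 + b ^ 2), ?_⟩
      have h1 : algebraMap M N a ^ 2 + algebraMap M N b ^ 2 ≠ 0 := by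
        rw [← map_pow, ← map_pow, ← map_add]
        exact (_root_.map_ne_zero _).2 h0
      refine inv_eq_of_mul_eq_one_right ?_
      simp only [map_div₀, map_add, map_pow, map_neg]
      field_simp
      linear_combination (- algebraMap M N b ^ 2) * hi

variable [IsRealClosed M]

theorem IsRealClosed.isSquare_of_mem_adjoin (hi : i ^ 2 = -1)
    (z : IntermediateField.adjoin M {i}) : IsSquare z := by
  obtain ⟨a, b, hab⟩ := exists_add_mul_of_mem_adjoin hi z.2
  obtain ⟨r, hr⟩ := IsSquare.of_nonneg (add_nonneg (sq_nonneg a) (sq_nonneg b))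
  wlog hr0 : 0 ≤ r generalizing r
  · exact this (-r) (by linear_combination hr) (by linarith)
  have har : |a| ≤ r := abs_le_of_sq_le_sq (by nlinarith [sq_nonneg b]) hr0
  rw [abs_le] at har
  obtain ⟨c, hc⟩ := IsSquare.of_nonneg (show 0 ≤ (r + a) / 2 by linarith)
  obtain ⟨d, hd⟩ := IsSquare.of_nonneg (show 0 ≤ (r - a) / 2 by linarith)
  have hcd : (2 * c * d) ^ 2 = b ^ 2 := by linear_combination (-4 * d * d) * hc
      - 2 * (r + a) * hd - hr
  have hcda : c ^ 2 - d ^ 2 = a := by linear_combination hd - hc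
  wlog hb : 2 * c * d = b generalizing d
  · refine this (-d) (by linear_combination hd) (by linear_combination hcd)
      (by linear_combination hcda) ?_
    rcases sq_eq_sq_iff_eq_or_eq_neg.1 hcd with h | h
    · exact absurd h hb
    · linear_combination -h
  refine ⟨algebraMap M _ c + algebraMap M _ d * ⟨i, IntermediateField.mem_adjoin_simple_self M i⟩,
    Subtype.ext ?_⟩
  rw [hab, ← hcda, ← hb]
  change _ = (algebraMap M N c + algebraMap M N d * i) * (algebraMap M N c + algebraMap M N d * i)
  simp only [map_sub, map_mul, map_pow, map_ofNat]
  linear_combination (- algebraMap M N d ^ 2) * hi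

theorem IsRealClosed.exists_add_mul_of_isGalois [FiniteDimensional M N] [IsGalois M N]
    (hi : i ^ 2 = -1) (z : N) :
    ∃ a b : M, z = algebraMap M N a + algebraMap M N b * i := by
  have : CharZero N := charZero_of_injective_algebraMap (algebraMap M N).injective
  have : Fact (Nat.Prime 2) := ⟨Nat.prime_two⟩
  have hcard : ∃ m, Module.finrank M N = 2 ^ m := by
    obtain ⟨S⟩ : Nonempty (Sylow 2 (N ≃ₐ[M] N)) := inferInstance
    have h1 : Module.finrank M (IntermediateField.fixedField (S : Subgroup (N ≃ₐ[M] N))) = 1 := by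
      apply finrank_eq_one_of_odd
      have h2 := Module.finrank_mul_finrank M
        (IntermediateField.fixedField (S : Subgroup (N ≃ₐ[M] N))) N
      rw [IntermediateField.finrank_fixedField_eq_card, ← IsGalois.card_aut_eq_finrank M N,
        ← Subgroup.index_mul_card (S : Subgroup (N ≃ₐ[M] N))] at h2
      rw [Nat.eq_of_mul_eq_mul_right Nat.card_pos h2]
      exact Nat.not_even_iff_odd.1 fun h ↦ S.not_dvd_index h.two_dvd
    have h2 := Module.finrank_mul_finrank M
        (IntermediateField.fixedField (S : Subgroup (N ≃ₐ[M] N))) N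
    rw [h1, one_mul, IntermediateField.finrank_fixedField_eq_card] at h2
    obtain ⟨m, hm⟩ := IsPGroup.iff_card.1 S.isPGroup'
    exact ⟨m, by rw [← h2]; exact hm⟩
  obtain ⟨m, hm⟩ := hcard
  let F := IntermediateField.adjoin M {i}
  obtain ⟨j, -, hj⟩ := (Nat.dvd_prime_pow Nat.prime_two).1
    (hm ▸ Dvd.intro_left _ (Module.finrank_mul_finrank M F N))
  have hj0 : j = 0 := by
    by_contra h0
    obtain ⟨l, rfl⟩ := Nat.exists_eq_succ_of_ne_zero h0
    obtain ⟨H, hH⟩ := Sylow.exists_subgroup_card_pow_prime (G := N ≃ₐ[F] N) 2 (n := l) (by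
      rw [IsGalois.card_aut_eq_finrank, hj]
      exact pow_dvd_pow 2 l.le_succ)
    have h2 := Module.finrank_mul_finrank F (IntermediateField.fixedField H) N
    rw [IntermediateField.finrank_fixedField_eq_card, hH, hj, pow_succ, mul_comm] at h2
    exact finrank_ne_two_of_forall_isSquare (isSquare_of_mem_adjoin hi)
      (Nat.eq_of_mul_eq_mul_left (by positivity) h2)
  rw [hj0, pow_zero] at hj
  obtain ⟨y, rfl⟩ := Algebra.mem_bot.1
    (Subalgebra.bot_eq_top_iff_finrank_eq_one.2 hj ▸ Algebra.mem_top (x := z))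
  exact exists_add_mul_of_mem_adjoin hi y.2

theorem IsRealClosed.exists_add_mul [Algebra.IsAlgebraic M N] (hi : i ^ 2 = -1) (z : N) :
    ∃ a b : M, z = algebraMap M N a + algebraMap M N b * i := by
  let Ω := AlgebraicClosure N
  have : Algebra.IsAlgebraic M Ω := Algebra.IsAlgebraic.trans M N Ω
  let F : IntermediateField M Ω := IntermediateField.adjoin M {algebraMap N Ω i, algebraMap N Ω z}
  have hF : FiniteDimensional M F :=
    IntermediateField.finiteDimensional_adjoin fun x _ ↦ Algebra.IsIntegral.isIntegral x
  let E := IntermediateField.normalClosure M F Ω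
  have hFE : F ≤ E := F.le_normalClosure
  have hmem : ∀ x ∈ ({algebraMap N Ω i, algebraMap N Ω z} : Set Ω), x ∈ E :=
    fun x hx ↦ hFE (IntermediateField.subset_adjoin _ _ hx)
  have : IsGalois M E := {}
  obtain ⟨a, b, hab⟩ := exists_add_mul_of_isGalois (M := M) (N := E) (i := ⟨algebraMap N Ω i,
    hmem _ (by simp)⟩) (Subtype.ext (by
      change algebraMap N Ω i ^ 2 = -1
      rw [← map_pow, hi, map_neg, map_one])) ⟨algebraMap N Ω z, hmem _ (by simp)⟩
  refine ⟨a, b, (algebraMap N Ω).injective ?_⟩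
  have := congrArg (algebraMap E Ω) hab
  rw [map_add, map_mul, ← IsScalarTower.algebraMap_apply,
    ← IsScalarTower.algebraMap_apply] at this
  rw [map_add, map_mul, ← IsScalarTower.algebraMap_apply, ← IsScalarTower.algebraMap_apply]
  exact this

end

theorem exists_ne_zero_of_card_lt {M ι S : Type*} [Field M] [Finite ι] (p : ι → Prop)
    (H : Finset S) (f : S → (ι → M) →ₗ[M] M) (h : H.card < Nat.card {j // p j}) :
    ∃ c : ι → M, c ≠ 0 ∧ (∀ j, ¬ p j → c j = 0) ∧ ∀ σ ∈ H, f σ c = 0 := by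
  classical
  have := Fintype.ofFinite {j // p j}
  let e : ({j // p j} → M) →ₗ[M] (ι → M) := Function.ExtendByZero.linearMap M Subtype.val
  have he : ∀ c j, e c j = Function.extend Subtype.val c 0 j := fun _ _ ↦ rfl
  obtain ⟨c, hc, hc0⟩ := Submodule.exists_mem_ne_zero_of_ne_bot
    (LinearMap.ker_ne_bot_of_finrank_lt (f := LinearMap.pi fun σ : H ↦ f σ ∘ₗ e) (by
      simpa using h))
  refine ⟨e c, fun h0 ↦ hc0 ?_, fun j hj ↦ ?_, fun σ hσ ↦ congrFun hc ⟨σ, hσ⟩⟩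
  · ext j
    have := congrFun h0 j
    rwa [he, Subtype.val_injective.extend_apply] at this
  · rw [he, Function.extend_apply' _ _ _ (by rintro ⟨⟨_, h⟩, rfl⟩; exact hj h)]
    rfl

theorem IsRealClosed.eq_and_eq_of_add_mul_eq {M N : Type*} [Field M] [LinearOrder M]
    [IsStrictOrderedRing M] [Field N] [Algebra M N] {i : N} (hi : i ^ 2 = -1) {a b c d : M}
    (h : algebraMap M N a + algebraMap M N b * i = algebraMap M N c + algebraMap M N d * i) :
    a = c ∧ b = d := by
  have h1 : algebraMap M N ((a - c) ^ 2 + (b - d) ^ 2) = algebraMap M N 0 := by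
    simp only [map_add, map_sub, map_pow, map_zero]
    linear_combination (algebraMap M N a - algebraMap M N c -
      (algebraMap M N b - algebraMap M N d) * i) * h +
        (algebraMap M N b - algebraMap M N d) ^ 2 * hi
  have h2 := (algebraMap M N).injective h1
  constructor <;> nlinarith [sq_nonneg (a - c), sq_nonneg (b - d)]

/-- Real part, imaginary part and conjugation on an algebraic extension of a real closed field
containing a square root of `-1`. -/
theorem IsRealClosed.exists_re_im_conj {M N : Type*} [Field M] [LinearOrder M]
    [IsStrictOrderedRing M] [IsRealClosed M] [Field N] [Algebra M N] [Algebra.IsAlgebraic M N]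
    {i : N} (hi : i ^ 2 = -1) :
    ∃ (re im : N →ₗ[M] M) (conj : N →ₐ[M] N),
      (∀ z, z = algebraMap M N (re z) + algebraMap M N (im z) * i) ∧
      (∀ a, re (algebraMap M N a) = a) ∧ (∀ a, im (algebraMap M N a) = 0) ∧
      (∀ z, re (z ^ 2) = re z ^ 2 - im z ^ 2) ∧
      (∀ z, re (conj z) = re z) ∧ (∀ z, im (conj z) = -im z) ∧ ∀ z, conj (conj z) = z := by
  choose re im h using fun z : N ↦ exists_add_mul (M := M) hi z
  have huniq : ∀ (z : N) (a b : M), z = algebraMap M N a + algebraMap M N b * i →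
      re z = a ∧ im z = b := fun z a b hz ↦
    eq_and_eq_of_add_mul_eq hi ((h z).symm.trans hz)
  have hadd : ∀ z w, re (z + w) = re z + re w ∧ im (z + w) = im z + im w := fun z w ↦
    huniq _ _ _ (by simp only [map_add]; linear_combination h z + h w)
  have hmul : ∀ z w, re (z * w) = re z * re w - im z * im w ∧
      im (z * w) = re z * im w + im z * re w := fun z w ↦
    huniq _ _ _ (by
      simp only [map_add, map_mul, map_sub]
      conv_lhs => rw [h z, h w]
      linear_combination (algebraMap M N (im z) * algebraMap M N (im w)) * hi)
  have halg : ∀ a, re (algebraMap M N a) = a ∧ im (algebraMap M N a) = 0 := fun a ↦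
    huniq _ _ _ (by simp)
  let conj : N →ₐ[M] N :=
    { toFun z := algebraMap M N (re z) - algebraMap M N (im z) * i
      map_one' := by
        have := halg 1
        rw [map_one] at this
        simp [this]
      map_zero' := by
        have := halg 0
        rw [map_zero] at this
        simp [this]
      map_add' z w := by
        simp only [hadd, map_add]
        ring
      map_mul' z w := by
        simp only [hmul, map_add, map_mul, map_sub]
        linear_combination (- algebraMap M N (im z) * algebraMap M N (im w)) * hi
      commutes' a := by simp [halg] }
  have hconj : ∀ z, re (conj z) = re z ∧ im (conj z) = -im z := fun z ↦
    huniq _ _ _ (by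
      change algebraMap M N (re z) - algebraMap M N (im z) * i = _
      rw [map_neg]
      ring)
  refine ⟨⟨⟨re, fun z w ↦ (hadd z w).1⟩, fun a z ↦ ?_⟩,
    ⟨⟨im, fun z w ↦ (hadd z w).2⟩, fun a z ↦ ?_⟩,
    conj, h, fun a ↦ (halg a).1, fun a ↦ (halg a).2, fun z ↦ ?_,
    fun z ↦ (hconj z).1, fun z ↦ (hconj z).2, fun z ↦ ?_⟩
  · simp [Algebra.smul_def, hmul, halg]
  · simp [Algebra.smul_def, hmul, halg]
  · simp only [LinearMap.coe_mk, AddHom.coe_mk, sq, hmul]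
  · rw [h (conj (conj z)), (hconj _).1, (hconj _).2, (hconj _).1, (hconj _).2, neg_neg, ← h]

section

variable {K E M : Type*} [Field K] [CharZero K] [Field E] [Algebra K E] [FiniteDimensional K E]
  [Field M] [Algebra K M]
  {ι : Type*} [Fintype ι] {v : ι → E}

theorem sum_sq_sum_mul_algHom {N : Type*} [Field N] [IsAlgClosed N] [Algebra M N] [Algebra K N]
    [IsScalarTower K M N]
    (hv : Pairwise fun i j ↦ Algebra.trace K E (v i * v j) = 0) (c : ι → M) :
    ∑ σ : E →ₐ[K] N, (∑ j, algebraMap M N (c j) * σ (v j)) ^ 2 =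
      algebraMap M N (∑ j, algebraMap K M (Algebra.trace K E (v j ^ 2)) * c j ^ 2) := by
  classical
  simp_rw [sq, Finset.sum_mul_sum]
  rw [Finset.sum_comm, map_sum]
  refine Finset.sum_congr rfl fun j _ ↦ ?_
  rw [Finset.sum_comm]
  have h1 : ∀ l, ∑ σ : E →ₐ[K] N, algebraMap M N (c j) * σ (v j) * (algebraMap M N (c l) * σ (v l))
      = algebraMap M N (c j * c l) * algebraMap K N (Algebra.trace K E (v j * v l)) := by
    intro l
    rw [trace_eq_sum_embeddings N, Finset.mul_sum]
    refine Finset.sum_congr rfl fun σ _ ↦ ?_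
    rw [map_mul, map_mul]
    ring
  simp_rw [h1]
  rw [Finset.sum_eq_single j (fun l _ hl ↦ by rw [hv hl.symm, map_zero, mul_zero]) (by simp),
    (algebraMap M N).map_mul, (algebraMap M N).map_mul, (algebraMap M N).map_mul,
    ← IsScalarTower.algebraMap_apply, mul_comm]

variable [LinearOrder M] [IsStrictOrderedRing M] [IsRealClosed M]

/-- The signature of the trace form of `E/K` with respect to the ordering induced by a real closed
field `M` tells whether `E` embeds into `M`. -/
theorem two_mul_card_pos_trace [Algebra.IsSeparable K E]
    (hv : Pairwise fun i j ↦ Algebra.trace K E (v i * v j) = 0)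
    (hv0 : ∀ j, Algebra.trace K E (v j ^ 2) ≠ 0) (hcard : Fintype.card ι = Module.finrank K E) :
    (IsEmpty (E →ₐ[K] M) →
      2 * Nat.card {j // 0 < algebraMap K M (Algebra.trace K E (v j ^ 2))} ≤ Module.finrank K E) ∧
    (Nonempty (E →ₐ[K] M) →
      Module.finrank K E <
        2 * Nat.card {j // 0 < algebraMap K M (Algebra.trace K E (v j ^ 2))}) := by
  classical
  let N := AlgebraicClosure M
  obtain ⟨i, hi⟩ := IsAlgClosed.exists_pow_nat_eq (-1 : N) two_pos
  obtain ⟨re, im, conj, hz, hre, him, hresq, hreconj, himconj, hconj⟩ :=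
    IsRealClosed.exists_re_im_conj (M := M) hi
  obtain ⟨β, hβ⟩ := Field.exists_primitive_element K E
  let cj : (E →ₐ[K] N) → (E →ₐ[K] N) := fun σ ↦ (conj.restrictScalars K).comp σ
  have hcjcj : ∀ σ, cj (cj σ) = σ := fun σ ↦ AlgHom.ext fun x ↦ hconj (σ x)
  let H : Finset (E →ₐ[K] N) := {σ | 0 < im (σ β)}
  let H' : Finset (E →ₐ[K] N) := {σ | im (σ β) < 0}
  let Z : Finset (E →ₐ[K] N) := {σ | im (σ β) = 0}
  have hHH' : H.card = H'.card := by
    refine Finset.card_bij' (fun σ _ ↦ cj σ) (fun σ _ ↦ cj σ) ?_ ?_ (fun σ _ ↦ hcjcj σ)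
      (fun σ _ ↦ hcjcj σ)
    · intro σ hσ
      simpa [H, H', cj, himconj] using hσ
    · intro σ hσ
      simpa [H, H', cj, himconj] using hσ
  have hsum : 2 * H.card + Z.card = Module.finrank K E := by
    rw [← AlgHom.card K E N, ← Finset.card_univ]
    have h1 : (Finset.univ : Finset (E →ₐ[K] N)) = (H ∪ H') ∪ Z := by
      ext σ
      rcases lt_trichotomy (im (σ β)) 0 with h | h | h <;> simp [H, H', Z, h]
    rw [h1, Finset.card_union_of_disjoint, Finset.card_union_of_disjoint, ← hHH']
    · ring
    · rw [Finset.disjoint_left]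
      intro σ
      simp only [H, H', Finset.mem_filter_univ]
      exact fun h h' ↦ lt_asymm h h'
    · rw [Finset.disjoint_left]
      intro σ
      simp only [H, H', Z, Finset.mem_filter_univ, Finset.mem_union]
      rintro (h | h) h' <;> exact h.ne (by simp [h'])
  have hZ : ∀ σ ∈ Z, ∀ x, σ x = algebraMap M N (re (σ x)) := by
    intro σ hσ x
    have h1 : cj σ = σ := by
      refine (Field.primitive_element_iff_algHom_eq_of_eval K N (fun x ↦ IsAlgClosed.splits _) β
        (cj σ)).1 hβ σ ?_
      change conj (σ β) = σ β
      have h2 : im (σ β) = 0 := by simpa [Z] using hσ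
      rw [hz (conj (σ β)), hreconj, himconj, h2, neg_zero, ← h2, ← hz]
    have h2 : im (σ x) = - im (σ x) := by
      rw [← himconj]
      exact congrArg im (DFunLike.congr_fun h1 x).symm
    have h3 : im (σ x) = 0 := by linarith
    conv_lhs => rw [hz (σ x), h3]
    simp
  have hZ' : Nonempty (E →ₐ[K] M) ↔ Z.Nonempty := by
    constructor
    · rintro ⟨τ⟩
      refine ⟨((Algebra.ofId M N).restrictScalars K).comp τ, ?_⟩
      exact Finset.mem_filter_univ _ |>.2 (him (τ β))
    · rintro ⟨σ, hσ⟩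
      exact ⟨{
        toFun := fun x ↦ re (σ x)
        map_one' := (algebraMap M N).injective (by rw [← hZ σ hσ, map_one, map_one])
        map_zero' := (algebraMap M N).injective (by rw [← hZ σ hσ, map_zero, map_zero])
        map_add' := fun x y ↦ (algebraMap M N).injective (by
          rw [(algebraMap M N).map_add, ← hZ σ hσ, ← hZ σ hσ, ← hZ σ hσ, map_add])
        map_mul' := fun x y ↦ (algebraMap M N).injective (by
          rw [(algebraMap M N).map_mul, ← hZ σ hσ, ← hZ σ hσ, ← hZ σ hσ, map_mul])
        commutes' := fun a ↦ (algebraMap M N).injective (by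
          rw [← hZ σ hσ, σ.commutes, ← IsScalarTower.algebraMap_apply]) }⟩
  let l (σ : E →ₐ[K] N) : (ι → M) →ₗ[M] N := Fintype.linearCombination M (fun j ↦ σ (v j))
  have hldef : ∀ σ c, l σ c = ∑ j, algebraMap M N (c j) * σ (v j) := fun σ c ↦ by
    simp [l, Fintype.linearCombination_apply, Algebra.smul_def]
  have hlconj : ∀ c σ, l (cj σ) c = conj (l σ c) := by
    intro c σ
    simp [hldef, cj, map_sum]
  have hl : ∀ c, ∑ σ : E →ₐ[K] N, (re (l σ c) ^ 2 - im (l σ c) ^ 2) =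
      ∑ j, algebraMap K M (Algebra.trace K E (v j ^ 2)) * c j ^ 2 := by
    intro c
    have := congrArg re (sum_sq_sum_mul_algHom (N := N) hv c)
    rw [hre, map_sum] at this
    simpa only [hresq, hldef] using this
  have hcases : ∀ (P : (E →ₐ[K] N) → Prop), (∀ σ ∈ H, P σ) → (∀ σ, P σ → P (cj σ)) →
      (∀ σ ∈ Z, P σ) → ∀ σ, P σ := by
    intro P h1 h2 h3 σ
    rcases lt_trichotomy (im (σ β)) 0 with h | h | h
    · rw [← hcjcj σ]
      exact h2 _ (h1 _ (by simpa [H, cj, himconj] using h))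
    · exact h3 _ (by simpa [Z] using h)
    · exact h1 _ (by simpa [H] using h)
  constructor
  · intro hemp
    rw [← not_nonempty_iff, hZ', Finset.not_nonempty_iff_eq_empty] at hemp
    rw [← hsum, hemp, Finset.card_empty, add_zero]
    by_contra! hlt
    obtain ⟨c, hc0, hc1, hc2⟩ := exists_ne_zero_of_card_lt
      (fun j ↦ 0 < algebraMap K M (Algebra.trace K E (v j ^ 2))) H (fun σ ↦ re ∘ₗ l σ) (by lia)
    obtain ⟨j, hj⟩ := Function.ne_iff.1 hc0
    have h1 : ∀ σ, re (l σ c) = 0 := hcases _ hc2 (fun σ h ↦ by rw [hlconj, hreconj, h])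
      (by simp [hemp])
    have h2 := hl c
    simp only [h1] at h2
    have h3 : 0 < ∑ j, algebraMap K M (Algebra.trace K E (v j ^ 2)) * c j ^ 2 := by
      refine Finset.sum_pos' (fun m _ ↦ ?_) ⟨j, Finset.mem_univ _, ?_⟩
      · by_cases hm : 0 < algebraMap K M (Algebra.trace K E (v m ^ 2))
        · positivity
        · simp [hc1 m hm]
      · refine mul_pos ?_ (sq_pos_of_ne_zero hj)
        by_contra hm
        exact hj (hc1 j hm)
    rw [← h2] at h3
    refine h3.not_ge (Finset.sum_nonpos fun σ _ ↦ ?_)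
    nlinarith [sq_nonneg (im (l σ c))]
  · intro hne
    rw [hZ', ← Finset.card_pos] at hne
    have hcompl : Nat.card {j // 0 < algebraMap K M (Algebra.trace K E (v j ^ 2))} +
        Nat.card {j // ¬ 0 < algebraMap K M (Algebra.trace K E (v j ^ 2))} =
          Module.finrank K E := by
      rw [← hcard, Nat.card_eq_fintype_card, Nat.card_eq_fintype_card,
        Fintype.card_subtype_compl]
      have := Fintype.card_subtype_le (fun j ↦ 0 < algebraMap K M (Algebra.trace K E (v j ^ 2)))
      lia
    by_contra! hlt
    obtain ⟨c, hc0, hc1, hc2⟩ := exists_ne_zero_of_card_lt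
      (fun j ↦ ¬ 0 < algebraMap K M (Algebra.trace K E (v j ^ 2))) H (fun σ ↦ im ∘ₗ l σ) (by lia)
    obtain ⟨j, hj⟩ := Function.ne_iff.1 hc0
    have h1 : ∀ σ, im (l σ c) = 0 := hcases _ hc2
      (fun σ h ↦ by rw [hlconj, himconj, h, neg_zero]) (fun σ hσ ↦ by
        have : l σ c = algebraMap M N (∑ j, c j * re (σ (v j))) := by
          rw [hldef, map_sum]
          exact Finset.sum_congr rfl fun m _ ↦ by rw [map_mul, ← hZ σ hσ]
        rw [this, him])
    have h2 := hl c
    simp only [h1] at h2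
    have hneg : ∀ m, ¬ 0 < algebraMap K M (Algebra.trace K E (v m ^ 2)) →
        algebraMap K M (Algebra.trace K E (v m ^ 2)) < 0 := fun m hm ↦
      lt_of_le_of_ne (not_lt.1 hm) ((_root_.map_ne_zero _).2 (hv0 m))
    have h3 : ∑ j, algebraMap K M (Algebra.trace K E (v j ^ 2)) * c j ^ 2 < 0 := by
      rw [← neg_pos, ← Finset.sum_neg_distrib]
      refine Finset.sum_pos' (fun m _ ↦ ?_) ⟨j, Finset.mem_univ _, ?_⟩
      · by_cases hm : 0 < algebraMap K M (Algebra.trace K E (v m ^ 2))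
        · simp [hc1 m (not_not.2 hm)]
        · nlinarith [hneg m hm, sq_nonneg (c m)]
      · rw [← neg_mul]
        refine mul_pos (neg_pos.2 (hneg j ?_)) (sq_pos_of_ne_zero hj)
        intro hm
        exact hj (hc1 j (not_not.2 hm))
    rw [← h2] at h3
    refine h3.not_ge (Finset.sum_nonneg fun σ _ ↦ ?_)
    nlinarith [sq_nonneg (re (l σ c))]

end

/-- Given two real closed fields inducing the same ordering on `K`, a finite extension of `K`
embedding into one of them embeds into the other. -/
theorem IsRealClosed.nonempty_algHom {K E L Ω : Type*} [Field K] [CharZero K] [Field E]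
    [Algebra K E] [FiniteDimensional K E]
    [Field L] [LinearOrder L] [IsStrictOrderedRing L] [IsRealClosed L] [Algebra K L]
    [Field Ω] [LinearOrder Ω] [IsStrictOrderedRing Ω] [IsRealClosed Ω] [Algebra K Ω]
    (hs : ∀ a : K, 0 ≤ algebraMap K L a → 0 ≤ algebraMap K Ω a) (h : Nonempty (E →ₐ[K] L)) :
    Nonempty (E →ₐ[K] Ω) := by
  have : Invertible (2 : K) := invertibleOfNonzero two_ne_zero
  have hsymm : (Algebra.traceForm K E).IsSymm := Algebra.traceForm_isSymm K
  obtain ⟨v, hv⟩ := LinearMap.BilinForm.exists_orthogonal_basis (B := Algebra.traceForm K E)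
    ⟨hsymm.eq⟩
  have hv1 : Pairwise fun i j ↦ Algebra.trace K E (v i * v j) = 0 := hv
  have hv0 : ∀ j, Algebra.trace K E (v j ^ 2) ≠ 0 := fun j h0 ↦
    LinearMap.IsOrthoᵢ.not_isOrtho_basis_self_of_separatingLeft (v := v) hv
      (traceForm_nondegenerate K E).1 j (by rwa [sq] at h0)
  have hL := two_mul_card_pos_trace (M := L) hv1 hv0 (Fintype.card_fin _)
  have hΩ := two_mul_card_pos_trace (M := Ω) hv1 hv0 (Fintype.card_fin _)
  have hpos : ∀ j, 0 < algebraMap K Ω (Algebra.trace K E (v j ^ 2)) ↔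
      0 < algebraMap K L (Algebra.trace K E (v j ^ 2)) := by
    intro j
    have h1 := (_root_.map_ne_zero (algebraMap K L)).2 (hv0 j)
    have h2 := (_root_.map_ne_zero (algebraMap K Ω)).2 (hv0 j)
    constructor
    · intro hj
      by_contra! hlt
      have := hs (-Algebra.trace K E (v j ^ 2)) (by rw [map_neg]; linarith)
      rw [map_neg] at this
      linarith
    · exact fun hj ↦ lt_of_le_of_ne (hs _ hj.le) h2.symm
  by_contra hemp
  have h1 := hΩ.1 (not_nonempty_iff.1 hemp)
  simp only [hpos] at h1
  exact h1.not_gt (hL.2 h)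

/-- The embedding of `IsRealClosed.nonempty_algHom` may be chosen compatible with the orderings. -/
theorem IsRealClosed.exists_algHom_nonneg {K E L Ω : Type*} [Field K] [CharZero K] [Field E]
    [Algebra K E] [FiniteDimensional K E]
    [Field L] [LinearOrder L] [IsStrictOrderedRing L] [IsRealClosed L] [Algebra K L]
    [Field Ω] [LinearOrder Ω] [IsStrictOrderedRing Ω] [IsRealClosed Ω] [Algebra K Ω]
    (hs : ∀ a : K, 0 ≤ algebraMap K L a → 0 ≤ algebraMap K Ω a) (τ : E →ₐ[K] L) :
    ∃ σ : E →ₐ[K] Ω, ∀ x, 0 ≤ τ x → 0 ≤ σ x := by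
  by_contra! hbad
  choose g hg hg' using hbad
  choose s hs' using fun σ ↦ IsSquare.of_nonneg (hg σ)
  have hint : ∀ y ∈ Set.range s, IsIntegral K y := by
    rintro _ ⟨σ, rfl⟩
    refine IsIntegral.of_pow two_pos ?_
    rw [sq, ← hs']
    exact (Algebra.IsIntegral.isIntegral (g σ)).map τ
  have : FiniteDimensional K (IntermediateField.adjoin K (Set.range s)) :=
    IntermediateField.finiteDimensional_adjoin hint
  have : FiniteDimensional K τ.fieldRange :=
    (AlgEquiv.ofInjectiveField τ).toLinearEquiv.finiteDimensional
  let E' := τ.fieldRange ⊔ IntermediateField.adjoin K (Set.range s)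
  obtain ⟨σ'⟩ := nonempty_algHom hs ⟨E'.val⟩
  let σ : E →ₐ[K] Ω := σ'.comp ((IntermediateField.inclusion le_sup_left).comp
    (AlgEquiv.ofInjectiveField τ).toAlgHom)
  have hmem : s σ ∈ E' := (le_sup_right : _ ≤ E') (IntermediateField.subset_adjoin _ _ ⟨σ, rfl⟩)
  have h1 : σ (g σ) = σ' ⟨s σ, hmem⟩ * σ' ⟨s σ, hmem⟩ := by
    rw [← map_mul]
    exact congrArg σ' (Subtype.ext (hs' σ))
  exact (hg' σ).not_ge (h1 ▸ mul_self_nonneg _)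

theorem sign_map_eq_sign_map {F L Ω : Type*} [Field F] [Ring L] [LinearOrder L]
    [IsStrictOrderedRing L] [Ring Ω] [LinearOrder Ω] [IsStrictOrderedRing Ω]
    {f : F →+* L} {g : F →+* Ω} (h : ∀ x, 0 ≤ f x → 0 ≤ g x) (x : F) :
    SignType.sign (f x) = SignType.sign (g x) := by
  have hpos : ∀ x, 0 < f x → 0 < g x := fun x hx ↦ lt_of_le_of_ne (h x hx.le) (by
    rintro h0
    rw [(map_eq_zero g).1 h0.symm, map_zero] at hx
    exact hx.false)
  rcases lt_trichotomy (f x) 0 with hx | hx | hx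
  · have := hpos (-x) (by rw [map_neg]; exact neg_pos.2 hx)
    rw [map_neg, neg_pos] at this
    rw [sign_neg hx, sign_neg this]
  · rw [(map_eq_zero f).1 hx, f.map_zero, g.map_zero, sign_zero, sign_zero]
  · rw [sign_pos hx, sign_pos (hpos x hx)]

theorem IsRealClosed.eval_mul_eval_pos_of_irreducible {M : Type*} [Field M] [LinearOrder M]
    [IsStrictOrderedRing M] [IsRealClosed M] {p : M[X]} (hp : Irreducible p) {a b : M}
    (hab : a ≤ b) (h : ∀ r, a ≤ r → r ≤ b → p.eval r ≠ 0) : 0 < p.eval a * p.eval b := by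
  have hmul : ∀ q : M[X], Irreducible q → p ∣ q → 0 < q.eval a * q.eval b →
      0 < p.eval a * p.eval b := by
    intro q hq hpq hpos
    obtain ⟨u, hu⟩ := hp.associated_of_dvd hq hpq
    obtain ⟨c, -, hc⟩ := isUnit_iff.1 u.isUnit
    rw [← hu, ← hc, eval_mul, eval_mul, eval_C, eval_C] at hpos
    have : 0 < c ^ 2 * (p.eval a * p.eval b) := by convert hpos using 1; ring
    exact pos_of_mul_pos_right this (sq_nonneg c)
  by_cases hroot : ∃ r, p.IsRoot r
  · obtain ⟨r, hr⟩ := hroot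
    have h1 := (irreducible_X_sub_C r).associated_of_dvd hp (dvd_iff_isRoot.2 hr)
    refine hmul _ (irreducible_X_sub_C r) h1.symm.dvd ?_
    simp only [eval_sub, eval_X, eval_C]
    by_cases har : a ≤ r
    · have hbr : b < r := not_le.1 fun hrb ↦ h r har hrb hr
      exact mul_pos_of_neg_of_neg (by linarith) (by linarith)
    · exact mul_pos (by linarith) (by linarith)
  · push Not at hroot
    let N := AlgebraicClosure M
    obtain ⟨i, hi⟩ := IsAlgClosed.exists_pow_nat_eq (-1 : N) two_pos
    obtain ⟨z, hz⟩ := IsAlgClosed.exists_aeval_eq_zero N p hp.degree_pos.ne'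
    obtain ⟨u, v, huv⟩ := exists_add_mul (M := M) hi z
    have hv : v ≠ 0 := by
      rintro rfl
      rw [map_zero, zero_mul, add_zero] at huv
      rw [huv, aeval_algebraMap_apply] at hz
      exact hroot u ((map_eq_zero _).1 hz)
    have hpos : ∀ x, 0 < ((X - C u) ^ 2 + C (v ^ 2)).eval x := fun x ↦ by
      simp only [eval_add, eval_pow, eval_sub, eval_X, eval_C]
      positivity
    have hdeg : ((X - C u) ^ 2 + C (v ^ 2)).natDegree = 2 := by
      rw [natDegree_add_C, natDegree_pow, natDegree_X_sub_C]
    have hq : Irreducible ((X - C u) ^ 2 + C (v ^ 2)) :=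
      irreducible_of_degree_le_three_of_not_isRoot (by rw [hdeg]; decide) fun x ↦ (hpos x).ne'
    refine hmul _ hq ?_ (mul_pos (hpos a) (hpos b))
    have hint : IsIntegral M z := Algebra.IsIntegral.isIntegral z
    have h1 := (minpoly.irreducible hint).associated_of_dvd hp (minpoly.dvd M z hz)
    refine h1.symm.dvd.trans (minpoly.dvd M z ?_)
    simp only [map_add, map_pow, map_sub, aeval_X, aeval_C]
    rw [huv]
    linear_combination (algebraMap M N v) ^ 2 * hi

/-- A form of the intermediate value theorem for polynomials over a real closed field. -/
theorem IsRealClosed.eval_mul_eval_pos {M : Type*} [Field M] [LinearOrder M]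
    [IsStrictOrderedRing M] [IsRealClosed M] {p : M[X]} {a b : M}
    (hab : a ≤ b) (h : ∀ r, a ≤ r → r ≤ b → p.eval r ≠ 0) : 0 < p.eval a * p.eval b := by
  induction p using WfDvdMonoid.induction_on_irreducible with
  | zero => exact absurd eval_zero (h a le_rfl hab)
  | unit u hu =>
    obtain ⟨c, hc, rfl⟩ := isUnit_iff.1 hu
    rw [eval_C, eval_C]
    exact mul_self_pos.2 hc.ne_zero
  | mul q p _ hp ih =>
    have h1 := eval_mul_eval_pos_of_irreducible hp hab fun r hr hr' h0 ↦ h r hr hr' (by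
      rw [eval_mul, h0, zero_mul])
    have h2 := ih fun r hr hr' h0 ↦ h r hr hr' (by rw [eval_mul, h0, mul_zero])
    rw [eval_mul, eval_mul]
    convert mul_pos h1 h2 using 1
    ring

theorem IsRealClosed.sign_eval_eq {M : Type*} [Field M] [LinearOrder M]
    [IsStrictOrderedRing M] [IsRealClosed M] {p : M[X]} {a b : M}
    (h : ∀ r, p.eval r = 0 → r < a ∧ r < b ∨ a < r ∧ b < r) :
    SignType.sign (p.eval a) = SignType.sign (p.eval b) := by
  wlog hab : a ≤ b generalizing a b
  · exact (this (fun r hr ↦ by have := h r hr; tauto) (le_of_not_ge hab)).symm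
  have := eval_mul_eval_pos (p := p) hab fun r hr hr' h0 ↦ by
    rcases h r h0 with h | h
    · exact h.1.not_ge hr
    · exact h.2.not_ge hr'
  rcases pos_and_pos_or_neg_and_neg_of_mul_pos this with h | h
  · rw [sign_pos h.1, sign_pos h.2]
  · rw [sign_neg h.1, sign_neg h.2]

theorem IsRealClosed.exists_isAlgebraic_sign_eq {K L : Type*} [Field K]
    [Field L] [LinearOrder L] [IsStrictOrderedRing L] [IsRealClosed L] [Algebra K L]
    (x : L) (S : Finset K[X]) :
    ∃ t : L, IsAlgebraic K t ∧
      ∀ p ∈ S, SignType.sign (aeval t p) = SignType.sign (aeval x p) := by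
  classical
  by_cases hx : IsAlgebraic K x
  · exact ⟨x, hx, fun _ _ ↦ rfl⟩
  let F : Subfield L := (algebraicClosure K L).toSubfield
  have hF : ∀ y, y ∈ F ↔ IsAlgebraic K y := fun _ ↦ mem_algebraicClosure_iff
  let R : Finset F := (S.biUnion fun p ↦ (p.aroots L).toFinset).subtype (· ∈ F)
  have hR : ∀ p ∈ S, p ≠ 0 → ∀ r, aeval r p = 0 → ∃ r' ∈ R, (r' : L) = r := by
    intro p hp hp0 r hr
    refine ⟨⟨r, (hF r).2 ⟨p, hp0, hr⟩⟩, ?_, rfl⟩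
    simp only [R, Finset.mem_subtype, Finset.mem_biUnion, Multiset.mem_toFinset]
    exact ⟨p, hp, mem_aroots.2 ⟨hp0, hr⟩⟩
  obtain ⟨t, ht1, ht2⟩ := Order.exists_between_finsets (α := F) (R.filter fun r ↦ (r : L) < x)
    (R.filter fun r ↦ x < (r : L)) (fun r hr s hs ↦
      show (r : L) < s from (Finset.mem_filter.1 hr).2.trans (Finset.mem_filter.1 hs).2)
  refine ⟨t, (hF t).1 t.2, fun p hp ↦ ?_⟩
  rcases eq_or_ne p 0 with rfl | hp0
  · simp
  rw [← eval_map_algebraMap, ← eval_map_algebraMap]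
  refine sign_eval_eq fun r hr ↦ ?_
  rw [eval_map_algebraMap] at hr
  obtain ⟨r, hrR, rfl⟩ := hR p hp hp0 r hr
  rcases lt_trichotomy (r : L) x with h | h | h
  · exact .inl ⟨ht1 r (Finset.mem_filter.2 ⟨hrR, h⟩), h⟩
  · exact absurd ((hF _).1 (h ▸ r.2)) hx
  · exact .inr ⟨ht2 r (Finset.mem_filter.2 ⟨hrR, h⟩), h⟩

theorem IsRealClosed.exists_sign_aeval_eq {K L Ω : Type*} [Field K] [CharZero K]
    [Field L] [LinearOrder L] [IsStrictOrderedRing L] [IsRealClosed L] [Algebra K L]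
    [Field Ω] [LinearOrder Ω] [IsStrictOrderedRing Ω] [IsRealClosed Ω] [Algebra K Ω]
    (hs : ∀ a : K, 0 ≤ algebraMap K L a → 0 ≤ algebraMap K Ω a) (x : L) (S : Finset K[X]) :
    ∃ ω : Ω, ∀ p ∈ S, SignType.sign (aeval ω p) = SignType.sign (aeval x p) := by
  obtain ⟨t, ht, htS⟩ := exists_isAlgebraic_sign_eq x S
  have := IntermediateField.adjoin.finiteDimensional ht.isIntegral
  obtain ⟨σ, hσ⟩ := exists_algHom_nonneg hs (IntermediateField.adjoin K {t}).val
  refine ⟨σ (IntermediateField.AdjoinSimple.gen K t), fun p hp ↦ ?_⟩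
  rw [← htS p hp, aeval_algHom_apply]
  refine (sign_map_eq_sign_map (f := (IntermediateField.adjoin K {t}).val.toRingHom)
    (g := σ.toRingHom) hσ _).symm.trans ?_
  congr 1
  exact (aeval_algHom_apply (IntermediateField.adjoin K {t}).val _ _).symm

/-- Given real closed fields `L` and `Ω` inducing the same signs on a ring `A`, the sign conditions
over `A` on one variable which can be realized in `L` can be realized in `Ω`. -/
theorem IsRealClosed.exists_sign_eval₂_eq {A L Ω : Type*} [CommRing A]
    [Field L] [LinearOrder L] [IsStrictOrderedRing L] [IsRealClosed L]
    [Field Ω] [LinearOrder Ω] [IsStrictOrderedRing Ω] [IsRealClosed Ω] {φ : A →+* L} {ψ : A →+* Ω}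
    (hs : ∀ a : A, SignType.sign (φ a) = SignType.sign (ψ a)) (x : L) (S : Finset A[X]) :
    ∃ ω : Ω, ∀ p ∈ S, SignType.sign (p.eval₂ ψ ω) = SignType.sign (p.eval₂ φ x) := by
  classical
  have hker : ∀ a, φ a = 0 ↔ ψ a = 0 := fun a ↦ by rw [← sign_eq_zero_iff, hs, sign_eq_zero_iff]
  let B := A ⧸ RingHom.ker φ
  let φ' : B →+* L := RingHom.kerLift φ
  have hφ' : Function.Injective φ' := RingHom.kerLift_injective φ
  have : IsDomain B := hφ'.isDomain φ'
  let ψ' : B →+* Ω := Ideal.Quotient.lift _ ψ fun a ha ↦ (hker a).1 ha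
  have hψ' : Function.Injective ψ' := by
    refine (injective_iff_map_eq_zero ψ').2 fun b hb ↦ ?_
    obtain ⟨a, rfl⟩ := Ideal.Quotient.mk_surjective b
    exact Ideal.Quotient.eq_zero_iff_mem.2 ((hker a).2 hb)
  let K := FractionRing B
  let fL : K →+* L := IsFractionRing.lift hφ'
  let fΩ : K →+* Ω := IsFractionRing.lift hψ'
  have hfL : ∀ b, fL (algebraMap B K b) = φ' b := IsFractionRing.lift_algebraMap hφ'
  have hfΩ : ∀ b, fΩ (algebraMap B K b) = ψ' b := IsFractionRing.lift_algebraMap hψ'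
  let _ : Algebra K L := fL.toAlgebra
  let _ : Algebra K Ω := fΩ.toAlgebra
  have : CharZero K := (algebraMap K L).charZero
  have hsK : ∀ a : K, 0 ≤ algebraMap K L a → 0 ≤ algebraMap K Ω a := by
    intro a ha
    change 0 ≤ fL a at ha
    change 0 ≤ fΩ a
    obtain ⟨b, c, hc, rfl⟩ := IsFractionRing.div_surjective (A := B) a
    obtain ⟨b, rfl⟩ := Ideal.Quotient.mk_surjective b
    obtain ⟨c, rfl⟩ := Ideal.Quotient.mk_surjective c
    rw [map_div₀, hfL, hfL] at ha
    rw [map_div₀, hfΩ, hfΩ]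
    change 0 ≤ φ b / φ c at ha
    change 0 ≤ ψ b / ψ c
    have h1 : 0 ≤ φ b * φ c := by
      by_cases h0 : φ c = 0
      · simp [h0]
      · have : φ b * φ c = φ b / φ c * φ c ^ 2 := by field_simp
        rw [this]
        positivity
    rw [← map_mul, ← sign_nonneg_iff, hs, sign_nonneg_iff, map_mul] at h1
    have : ψ b / ψ c = ψ b * ψ c / ψ c ^ 2 := by
      by_cases h0 : ψ c = 0
      · simp [h0]
      · field_simp
    rw [this]
    positivity
  let j : A →+* K := (algebraMap B K).comp (Ideal.Quotient.mk _)
  obtain ⟨ω, hω⟩ := exists_sign_aeval_eq hsK x (S.image (Polynomial.map j))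
  refine ⟨ω, fun p hp ↦ ?_⟩
  have h1 := hω _ (Finset.mem_image_of_mem _ hp)
  rw [aeval_def, aeval_def, eval₂_map, eval₂_map] at h1
  rwa [show (algebraMap K Ω).comp j = ψ from RingHom.ext fun a ↦ hfΩ _,
    show (algebraMap K L).comp j = φ from RingHom.ext fun a ↦ hfL _] at h1

section

open Filter

variable {I : Type*} {l : Ultrafilter I} {Ω : Type*} [Field Ω]

theorem Filter.Germ.isRealClosed [LinearOrder Ω] [IsStrictOrderedRing Ω] [IsRealClosed Ω] :
    IsRealClosed (Germ (l : Filter I) Ω) := by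
  refine IsRealClosed.of_linearOrderedField (fun {x} hx ↦ ?_) fun {f} hf ↦ ?_
  · induction x using Germ.inductionOn with
    | _ x =>
      have h1 : ∀ j, ∃ y, 0 ≤ x j → x j = y * y := fun j ↦ by
        by_cases hj : 0 ≤ x j
        · obtain ⟨y, hy⟩ := IsSquare.of_nonneg hj
          exact ⟨y, fun _ ↦ hy⟩
        · exact ⟨0, fun h ↦ absurd h hj⟩
      choose y hy using h1
      exact ⟨(y : Germ (l : Filter I) Ω), Germ.coe_eq.2 ((Germ.coe_le.1 hx).mono hy)⟩
  · have hf0 : f ≠ 0 := by rintro rfl; simp at hf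
    have hmon := monic_mul_leadingCoeff_inv hf0
    obtain ⟨g, hg, hdeg, hgm⟩ := lifts_and_natDegree_eq_and_monic
      (f := Germ.coeRingHom (R := Ω) (l : Filter I)) (p := f * C f.leadingCoeff⁻¹) (by
        rw [lifts_iff_coeff_lifts]
        intro n
        exact (Germ.inductionOn (p := fun y ↦
            y ∈ Set.range (Germ.coeRingHom (R := Ω) (l : Filter I)))
          _ fun y ↦ ⟨y, rfl⟩)) hmon
    rw [natDegree_mul_leadingCoeff_inv _ hf0] at hdeg
    have hroot : ∀ j, ∃ y, (g.map (Pi.evalRingHom (fun _ ↦ Ω) j)).IsRoot y := fun j ↦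
      IsRealClosed.exists_isRoot_of_odd_natDegree (by rwa [hgm.natDegree_map, hdeg])
    choose y hy using hroot
    refine ⟨Germ.coeRingHom (l : Filter I) y, ?_⟩
    have h1 : g.eval y = 0 := funext fun j ↦ by
      rw [← Pi.evalRingHom_apply (fun _ : I ↦ Ω) j (g.eval y), ← eval₂_at_apply, ← eval_map]
      exact hy j
    have h2 : (f * C f.leadingCoeff⁻¹).eval (Germ.coeRingHom (l : Filter I) y) = 0 := by
      rw [← hg, eval_map, eval₂_at_apply, h1, map_zero]
    rw [eval_mul, eval_C] at h2
    exact (mul_eq_zero.1 h2).resolve_right (inv_ne_zero (leadingCoeff_ne_zero.2 hf0))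

theorem Filter.Germ.eventually_sign_eq [LinearOrder Ω] [IsStrictOrderedRing Ω] (y : I → Ω) :
    ∀ᶠ j in l, SignType.sign (y j) = SignType.sign (y : Germ (l : Filter I) Ω) := by
  rcases lt_trichotomy 0 (y : Germ (l : Filter I) Ω) with h | h | h
  · rw [sign_pos h]
    exact (Germ.coe_pos.1 h).mono fun _ ↦ sign_pos
  · rw [← h, sign_zero]
    exact (Germ.coe_eq.1 h).mono fun j hj ↦ by
      rw [← hj]
      exact sign_zero
  · rw [sign_neg h]
    exact (Germ.coe_lt.1 h).mono fun _ ↦ sign_neg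

end

/-- Given real closed fields `L` and `Ω` inducing the same signs on a ring `A`, the sign conditions
over `A` on finitely many variables which can be realized in `L` can be realized in `Ω`. -/
theorem IsRealClosed.exists_sign_mvPolynomial_eval₂_eq {L : Type*}
    [Field L] [LinearOrder L] [IsStrictOrderedRing L] [IsRealClosed L] (σ : Type) [Finite σ]
    (A Ω : Type) [CommRing A] [Field Ω] [LinearOrder Ω] [IsStrictOrderedRing Ω]
    [IsRealClosed Ω] (φ : A →+* L) (ψ : A →+* Ω)
    (hs : ∀ a : A, SignType.sign (φ a) = SignType.sign (ψ a)) (x : σ → L)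
    (S : Finset (MvPolynomial σ A)) :
    ∃ ω : σ → Ω, ∀ p ∈ S, SignType.sign (p.eval₂ ψ ω) = SignType.sign (p.eval₂ φ x) := by
  classical
  induction σ using Finite.induction_empty_option generalizing A Ω with
  | of_equiv e ih =>
    obtain ⟨ω, hω⟩ := ih A Ω φ ψ hs (x ∘ e) (S.image (MvPolynomial.rename e.symm))
    refine ⟨ω ∘ e.symm, fun p hp ↦ ?_⟩
    have := hω _ (Finset.mem_image_of_mem _ hp)
    rwa [MvPolynomial.eval₂_rename, MvPolynomial.eval₂_rename, Function.comp_assoc,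
      e.self_comp_symm, Function.comp_id] at this
  | h_empty =>
    refine ⟨isEmptyElim, fun p _ ↦ ?_⟩
    obtain ⟨a, rfl⟩ := MvPolynomial.C_surjective _ p
    rw [MvPolynomial.eval₂_C, MvPolynomial.eval₂_C, hs]
  | @h_option τ _ ih =>
    choose w hw using fun S : Finset A[X] ↦ exists_sign_eval₂_eq hs (x none) S
    let l : Ultrafilter (Finset A[X]) := Ultrafilter.of Filter.atTop
    have hl : ∀ p : A[X], ∀ᶠ S in (l : Filter (Finset A[X])), p ∈ S := fun p ↦
      Ultrafilter.of_le _ ((Filter.eventually_ge_atTop {p}).mono fun S hS ↦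
        Finset.singleton_subset_iff.1 hS)
    let Ω' := Filter.Germ (l : Filter (Finset A[X])) Ω
    have : IsRealClosed Ω' := Filter.Germ.isRealClosed
    let π : (Finset A[X] → Ω) →+* Ω' := Filter.Germ.coeRingHom _
    let c : Ω →+* (Finset A[X] → Ω) := Pi.constRingHom _ _
    let ψ₀ : A[X] →+* (Finset A[X] → Ω) := eval₂RingHom (c.comp ψ) w
    have hψ₀ : ∀ p S, ψ₀ p S = p.eval₂ ψ (w S) := fun p S ↦
      hom_eval₂ p (c.comp ψ) (Pi.evalRingHom (fun _ ↦ Ω) S) w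
    have hs' : ∀ p : A[X], SignType.sign (eval₂RingHom φ (x none) p) =
        SignType.sign ((π.comp ψ₀) p) := by
      intro p
      obtain ⟨S, hS, hpS⟩ := ((Filter.Germ.eventually_sign_eq (l := l) (ψ₀ p)).and (hl p)).exists
      refine Eq.trans ?_ hS
      rw [hψ₀]
      exact (hw S p hpS).symm
    obtain ⟨ω, hω⟩ := ih A[X] Ω' _ _ hs' (fun j ↦ x (some j))
      (S.image (MvPolynomial.optionEquivRight A τ))
    choose v hv using fun j ↦ Filter.Germ.inductionOn (p := fun y ↦ ∃ v, π v = y) (ω j)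
      fun v ↦ ⟨v, rfl⟩
    let u : Option τ → (Finset A[X] → Ω) := fun o ↦ o.elim w v
    have hu : ∀ p : MvPolynomial (Option τ) A, π (p.eval₂ (c.comp ψ) u) =
        (MvPolynomial.optionEquivRight A τ p).eval₂ (π.comp ψ₀) ω := by
      intro p
      induction p using MvPolynomial.induction_on with
      | C a =>
        rw [MvPolynomial.optionEquivRight_C, MvPolynomial.eval₂_C, MvPolynomial.eval₂_C]
        simp [ψ₀]
      | add p q hp hq => rw [map_add, MvPolynomial.eval₂_add, map_add, hp, hq,
          MvPolynomial.eval₂_add]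
      | mul_X p o hp =>
        rw [map_mul, MvPolynomial.eval₂_mul, map_mul, hp, MvPolynomial.eval₂_mul,
          MvPolynomial.eval₂_X]
        congr 1
        cases o with
        | none =>
          rw [MvPolynomial.optionEquivRight_X_none, MvPolynomial.eval₂_C]
          simp [ψ₀, u]
        | some j =>
          rw [MvPolynomial.optionEquivRight_X_some, MvPolynomial.eval₂_X]
          exact hv j
    have hx : ∀ p : MvPolynomial (Option τ) A, p.eval₂ φ x =
        (MvPolynomial.optionEquivRight A τ p).eval₂ (eval₂RingHom φ (x none))
          (fun j ↦ x (some j)) := by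
      intro p
      induction p using MvPolynomial.induction_on with
      | C a =>
        rw [MvPolynomial.optionEquivRight_C, MvPolynomial.eval₂_C, MvPolynomial.eval₂_C]
        simp
      | add p q hp hq => rw [map_add, MvPolynomial.eval₂_add, hp, hq, MvPolynomial.eval₂_add]
      | mul_X p o hp =>
        rw [map_mul, MvPolynomial.eval₂_mul, hp, MvPolynomial.eval₂_mul, MvPolynomial.eval₂_X]
        congr 1
        cases o with
        | none =>
          rw [MvPolynomial.optionEquivRight_X_none, MvPolynomial.eval₂_C]
          simp
        | some j => rw [MvPolynomial.optionEquivRight_X_some, MvPolynomial.eval₂_X]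
    obtain ⟨T, hT⟩ := ((Filter.eventually_all_finset S).2 fun p _ ↦
      Filter.Germ.eventually_sign_eq (l := l) (p.eval₂ (c.comp ψ) u)).exists
    refine ⟨fun o ↦ u o T, fun p hp ↦ ?_⟩
    have h1 : p.eval₂ ψ (fun o ↦ u o T) = p.eval₂ (c.comp ψ) u T :=
      (MvPolynomial.eval₂_comp_left (Pi.evalRingHom (fun _ ↦ Ω) T) (c.comp ψ) u p).symm
    rw [h1, hT p hp, hx, ← hω _ (Finset.mem_image_of_mem _ hp), ← hu]
    rfl

namespace FieldDeriv

variable {F : Type} [Field F] (D : FieldDeriv F)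

theorem map_zero : D.d 0 = 0 := by
  simpa using D.map_add 0 0

theorem map_one : D.d 1 = 0 := by
  simpa using D.leibniz 1 1

/-- A derivation as an additive homomorphism. -/
def toAddMonoidHom : F →+ F where
  toFun := D.d
  map_zero' := D.map_zero
  map_add' := D.map_add

theorem map_sum {ι : Type*} (s : Finset ι) (f : ι → F) :
    D.d (∑ i ∈ s, f i) = ∑ i ∈ s, D.d (f i) :=
  _root_.map_sum D.toAddMonoidHom f s

theorem map_inv (x : F) : D.d x⁻¹ = -D.d x * (x⁻¹ * x⁻¹) := by
  rcases eq_or_ne x 0 with rfl | hx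
  · simp [D.map_zero]
  · have h := D.leibniz x x⁻¹
    rw [mul_inv_cancel₀ hx, D.map_one] at h
    have h2 : x * D.d x⁻¹ = -D.d x * x⁻¹ := by linear_combination -h
    rw [← mul_assoc, ← h2, mul_comm x, mul_assoc, mul_inv_cancel₀ hx, mul_one]

/-- The coefficientwise action of a derivation on polynomials. -/
noncomputable def mapCoeff {ν : Type} (p : MvPolynomial ν F) : MvPolynomial ν F :=
  ∑ m ∈ p.support, MvPolynomial.monomial m (D.d (p.coeff m))

variable {ν : Type}

@[simp]
theorem coeff_mapCoeff (p : MvPolynomial ν F) (m : ν →₀ ℕ) :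
    (D.mapCoeff p).coeff m = D.d (p.coeff m) := by
  classical
  rw [mapCoeff, MvPolynomial.coeff_sum]
  simp only [MvPolynomial.coeff_monomial, Finset.sum_ite_eq', MvPolynomial.mem_support_iff]
  split_ifs with h
  · rfl
  · rw [not_not.1 h, D.map_zero]

theorem mapCoeff_add (p q : MvPolynomial ν F) :
    D.mapCoeff (p + q) = D.mapCoeff p + D.mapCoeff q := by
  ext m
  simp [D.map_add]

theorem mapCoeff_mul (p q : MvPolynomial ν F) :
    D.mapCoeff (p * q) = p * D.mapCoeff q + D.mapCoeff p * q := by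
  classical
  ext m
  simp only [coeff_mapCoeff, MvPolynomial.coeff_mul, MvPolynomial.coeff_add, D.map_sum,
    D.leibniz, Finset.sum_add_distrib]

theorem mapCoeff_C (a : F) :
    D.mapCoeff (MvPolynomial.C a : MvPolynomial ν F) = MvPolynomial.C (D.d a) := by
  classical
  ext m
  rw [coeff_mapCoeff, MvPolynomial.coeff_C, MvPolynomial.coeff_C]
  split_ifs
  · rfl
  · exact D.map_zero

theorem mapCoeff_X (j : ν) : D.mapCoeff (MvPolynomial.X j : MvPolynomial ν F) = 0 := by
  classical
  ext m
  rw [coeff_mapCoeff, MvPolynomial.coeff_X]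
  split_ifs
  · simp [D.map_one]
  · simp [D.map_zero]

theorem mapCoeff_smul (a : F) (p : MvPolynomial ν F) :
    D.mapCoeff (a • p) = a • D.mapCoeff p + D.d a • p := by
  ext m
  simp [D.leibniz]

/-- A space of polynomials stable under a coefficientwise derivation is spanned by its elements
with constant coefficients. -/
theorem le_span_constant_coeff (V : Submodule F (MvPolynomial ν F))
    (hV : ∀ v ∈ V, D.mapCoeff v ∈ V) :
    V ≤ Submodule.span F {v | v ∈ V ∧ ∀ m, D.d (v.coeff m) = 0} := by
  classical
  have key : ∀ N : ℕ, ∀ v ∈ V, v.support.card = N →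
      v ∈ Submodule.span F {v | v ∈ V ∧ ∀ m, D.d (v.coeff m) = 0} := by
    intro N
    induction N using Nat.strong_induction_on with
    | _ N ih =>
      intro w hw hN
      rcases eq_or_ne w 0 with rfl | hw0
      · exact Submodule.zero_mem _
      have hlt : ∀ u : MvPolynomial ν F, u.support ⊂ w.support → u ∈ V →
          u ∈ Submodule.span F {v | v ∈ V ∧ ∀ m, D.d (v.coeff m) = 0} := fun u hu huV ↦
        ih _ (hN ▸ Finset.card_lt_card hu) u huV rfl
      by_cases hex : ∃ u ∈ V, u ≠ 0 ∧ u.support ⊂ w.support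
      · obtain ⟨u, huV, hu0, hu⟩ := hex
        obtain ⟨m, hm⟩ := MvPolynomial.ne_zero_iff.1 hu0
        set c := w.coeff m / u.coeff m with hc
        have hsub : (w - c • u).support ⊂ w.support := by
          refine (Finset.ssubset_iff_of_subset fun i hi ↦ ?_).2
            ⟨m, hu.1 (MvPolynomial.mem_support_iff.2 hm), ?_⟩
          · by_contra hiw
            have hiu : i ∉ u.support := fun h ↦ hiw (hu.1 h)
            rw [MvPolynomial.notMem_support_iff] at hiw hiu
            simp [hiw, hiu] at hi
          · rw [MvPolynomial.notMem_support_iff, MvPolynomial.coeff_sub, MvPolynomial.coeff_smul,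
              hc, smul_eq_mul, div_mul_cancel₀ _ hm, sub_self]
        have h := Submodule.add_mem _ (hlt _ hsub (V.sub_mem hw (V.smul_mem c huV)))
          (Submodule.smul_mem _ c (hlt u hu huV))
        rwa [sub_add_cancel] at h
      · push Not at hex
        obtain ⟨m, hm⟩ := MvPolynomial.ne_zero_iff.1 hw0
        set u := (w.coeff m)⁻¹ • w with hu
        have huV : u ∈ V := V.smul_mem _ hw
        have hd : D.mapCoeff u = 0 := by
          by_contra h
          refine hex _ (hV u huV) h ((Finset.ssubset_iff_of_subset fun i hi ↦ ?_).2
            ⟨m, MvPolynomial.mem_support_iff.2 hm, ?_⟩)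
          · by_contra hiw
            rw [MvPolynomial.notMem_support_iff] at hiw
            simp [hu, hiw, D.map_zero] at hi
          · rw [MvPolynomial.notMem_support_iff, coeff_mapCoeff, hu, MvPolynomial.coeff_smul,
              smul_eq_mul, inv_mul_cancel₀ hm, D.map_one]
        have huc : ∀ i, D.d (u.coeff i) = 0 := fun i ↦ by
          rw [← coeff_mapCoeff, hd, MvPolynomial.coeff_zero]
        have h := Submodule.smul_mem _ (w.coeff m) (Submodule.subset_span (R := F)
          (show u ∈ {v | v ∈ V ∧ ∀ m, D.d (v.coeff m) = 0} from ⟨huV, huc⟩))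
        rwa [hu, smul_smul, mul_inv_cancel₀ hm, one_smul] at h
  exact fun v hv ↦ key _ v hv rfl

end FieldDeriv

theorem Matrix.det_mvPolynomialX_eval₂ {m A E : Type*} [Fintype m] [DecidableEq m] [CommRing A]
    [CommRing E] (f : A →+* E) (Z : Matrix m m E) :
    (Matrix.mvPolynomialX m m A).det.eval₂ f (fun q ↦ Z q.1 q.2) = Z.det := by
  rw [← MvPolynomial.coe_eval₂Hom, RingHom.map_det]
  congr 1
  ext i j
  simp [Matrix.mvPolynomialX]

theorem IsRealClosed.exists_matrix_eval₂_eq_zero {L : Type*} [Field L] [LinearOrder L]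
    [IsStrictOrderedRing L] [IsRealClosed L] {n : ℕ} {A Ω : Type} [CommRing A]
    [IsNoetherianRing A] [Field Ω] [LinearOrder Ω] [IsStrictOrderedRing Ω] [IsRealClosed Ω]
    (φ : A →+* L) (ψ : A →+* Ω) (hs : ∀ a, SignType.sign (φ a) = SignType.sign (ψ a))
    (X : Matrix (Fin n) (Fin n) L) (hX : X.det ≠ 0)
    (J : Set (MvPolynomial (Fin n × Fin n) A))
    (hJ : ∀ p ∈ J, p.eval₂ φ (fun q ↦ X q.1 q.2) = 0) :
    ∃ Y : Matrix (Fin n) (Fin n) Ω, Y.det ≠ 0 ∧ ∀ p ∈ J, p.eval₂ ψ (fun q ↦ Y q.1 q.2) = 0 := by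
  classical
  obtain ⟨S, hSJ, hS⟩ := (Submodule.fg_span_iff_fg_span_finset_subset J).1
    (IsNoetherian.noetherian (Submodule.span (MvPolynomial (Fin n × Fin n) A) J))
  obtain ⟨ω, hω⟩ := IsRealClosed.exists_sign_mvPolynomial_eval₂_eq (Fin n × Fin n) A Ω φ ψ hs
    (fun q ↦ X q.1 q.2) (insert (Matrix.mvPolynomialX (Fin n) (Fin n) A).det S)
  refine ⟨Matrix.of fun i j ↦ ω (i, j), fun h ↦ hX ?_, fun p hp ↦ ?_⟩
  · have h1 := hω _ (Finset.mem_insert_self _ _)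
    have h2 := Matrix.det_mvPolynomialX_eval₂ ψ (Matrix.of fun i j ↦ ω (i, j))
    rw [h] at h2
    simp only [Matrix.of_apply, Prod.mk.eta] at h2
    rw [Matrix.det_mvPolynomialX_eval₂, h2, sign_zero, eq_comm, sign_eq_zero_iff] at h1
    exact h1
  · have hle : Submodule.span (MvPolynomial (Fin n × Fin n) A) J ≤
        RingHom.ker (MvPolynomial.eval₂Hom ψ ω) := by
      rw [hS]
      refine Ideal.span_le.2 fun p hp ↦ ?_
      have h1 := hω p (Finset.mem_insert_of_mem hp)
      rw [hJ p (hSJ hp), sign_zero, sign_eq_zero_iff] at h1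
      exact h1
    exact hle (Submodule.subset_span hp)

section

variable {K L : Type} [Field K] [Field L] [Algebra K L] {n : ℕ}

/-- Multiplication of the generic matrix on the left by `F`. -/
noncomputable def Matrix.mulGeneric (F : Matrix (Fin n) (Fin n) L) :
    MvPolynomial (Fin n × Fin n) K →ₐ[K] MvPolynomial (Fin n × Fin n) L :=
  MvPolynomial.aeval fun q ↦ ∑ l, MvPolynomial.C (F q.1 l) * MvPolynomial.X (l, q.2)

theorem Matrix.eval₂_mulGeneric {M : Type*} [CommRing M] (g : L →+* M)
    (F : Matrix (Fin n) (Fin n) L) (Z : Matrix (Fin n) (Fin n) M)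
    (P : MvPolynomial (Fin n × Fin n) K) :
    (F.mulGeneric P).eval₂ g (fun q ↦ Z q.1 q.2) =
      P.eval₂ (g.comp (algebraMap K L)) (fun q ↦ (F.map g * Z) q.1 q.2) := by
  have h : (MvPolynomial.eval₂Hom g fun q ↦ Z q.1 q.2).comp
      (F.mulGeneric (K := K)).toRingHom =
      MvPolynomial.eval₂Hom (g.comp (algebraMap K L)) (fun q ↦ (F.map g * Z) q.1 q.2) := by
    refine MvPolynomial.ringHom_ext (fun a ↦ ?_) fun q ↦ ?_
    · simp [Matrix.mulGeneric, MvPolynomial.algebraMap_eq,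
        IsScalarTower.algebraMap_apply K L (MvPolynomial (Fin n × Fin n) L)]
    · simp [Matrix.mulGeneric, Matrix.mul_apply]
  exact RingHom.congr_fun h P

/-- The derivative of the value of a polynomial at a fundamental matrix is again such a value, and
the same polynomial computes the coefficientwise derivative at `F * X`. -/
theorem FieldDeriv.exists_deriv_polynomial {L' : Type} [Field L'] [Algebra K L']
    (dK : FieldDeriv K) (d : FieldDeriv L) (d' : FieldDeriv L')
    (hd : ∀ a, d.d (algebraMap K L a) = algebraMap K L (dK.d a))
    (hd' : ∀ a, d'.d (algebraMap K L' a) = algebraMap K L' (dK.d a))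
    (A : Matrix (Fin n) (Fin n) K)
    (F : Matrix (Fin n) (Fin n) L) (hF : ∀ i j, d.d (F i j) = (A.map (algebraMap K L) * F) i j)
    (F' : Matrix (Fin n) (Fin n) L')
    (hF' : ∀ i j, d'.d (F' i j) = (A.map (algebraMap K L') * F') i j)
    (P : MvPolynomial (Fin n × Fin n) K) :
    ∃ Q : MvPolynomial (Fin n × Fin n) K,
      d'.d (MvPolynomial.aeval (fun q ↦ F' q.1 q.2) P) =
        MvPolynomial.aeval (fun q ↦ F' q.1 q.2) Q ∧
      d.mapCoeff (F.mulGeneric P) = F.mulGeneric Q := by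
  induction P using MvPolynomial.induction_on with
  | C a =>
    refine ⟨MvPolynomial.C (dK.d a), by simp [hd'], ?_⟩
    have h : ∀ a : K, F.mulGeneric (MvPolynomial.C a) = MvPolynomial.C (algebraMap K L a) :=
      fun a ↦ (F.mulGeneric (K := K)).commutes a
    rw [h, h, d.mapCoeff_C, hd]
  | add P Q hP hQ =>
    obtain ⟨P', hP1, hP2⟩ := hP
    obtain ⟨Q', hQ1, hQ2⟩ := hQ
    exact ⟨P' + Q', by simp [d'.map_add, hP1, hQ1], by simp [d.mapCoeff_add, hP2, hQ2]⟩
  | mul_X P q hP =>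
    obtain ⟨P', hP1, hP2⟩ := hP
    refine ⟨P * ∑ l, MvPolynomial.C (A q.1 l) * MvPolynomial.X (l, q.2) + P' * MvPolynomial.X q,
      ?_, ?_⟩
    · simp [d'.leibniz, hP1, hF', Matrix.mul_apply]
    · have hX : ∀ q : Fin n × Fin n, F.mulGeneric (K := K) (MvPolynomial.X q) =
          ∑ l, MvPolynomial.C (F q.1 l) * MvPolynomial.X (l, q.2) := fun q ↦ by
        simp [Matrix.mulGeneric]
      have hC : ∀ a : K, F.mulGeneric (MvPolynomial.C a) = MvPolynomial.C (algebraMap K L a) :=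
        fun a ↦ (F.mulGeneric (K := K)).commutes a
      have hs : ∀ f : Fin n → MvPolynomial (Fin n × Fin n) L,
          d.mapCoeff (∑ l, f l) = ∑ l, d.mapCoeff (f l) := fun f ↦ by
        ext m; simp [d.map_sum, MvPolynomial.coeff_sum]
      have h1 : d.mapCoeff (F.mulGeneric (K := K) (MvPolynomial.X q)) =
          F.mulGeneric (∑ l, MvPolynomial.C (A q.1 l) * MvPolynomial.X (l, q.2)) := by
        rw [hX, hs]
        simp only [_root_.map_sum, _root_.map_mul, hC, hX, d.mapCoeff_mul, d.mapCoeff_C,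
          d.mapCoeff_X, hF, Matrix.mul_apply, mul_zero, zero_add, Finset.mul_sum, Finset.sum_mul,
          Matrix.map_apply]
        rw [Finset.sum_comm]
        simp only [mul_assoc]
      rw [_root_.map_mul, d.mapCoeff_mul, hP2, h1, _root_.map_add, _root_.map_mul, _root_.map_mul]

end

/-- The algebraic relations over `K` of a fundamental matrix of one real differential field are
satisfied by a constant translate of a fundamental matrix of the other. -/
theorem FieldDeriv.exists_const_matrix {K : Type} [Field K] {k : Type} [Field k] [Algebra k K]
    [IsRealClosed k] (dK : FieldDeriv K)
    (hconst : ∀ a : K, dK.d a = 0 ↔ a ∈ Set.range (algebraMap k K)) {n : ℕ}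
    (A : Matrix (Fin n) (Fin n) K)
    {L₁ L₂ : Type} [Field L₁] [LinearOrder L₁] [IsStrictOrderedRing L₁]
    [Field L₂] [LinearOrder L₂] [IsStrictOrderedRing L₂] [Algebra K L₁] [Algebra K L₂]
    (hord : ∀ a : K, 0 ≤ algebraMap K L₁ a ↔ 0 ≤ algebraMap K L₂ a)
    (d₁ : FieldDeriv L₁) (d₂ : FieldDeriv L₂)
    (hd₁ : ∀ a, d₁.d (algebraMap K L₁ a) = algebraMap K L₁ (dK.d a))
    (hd₂ : ∀ a, d₂.d (algebraMap K L₂ a) = algebraMap K L₂ (dK.d a))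
    (hc₁ : ∀ x, d₁.d x = 0 → ∃ a : K, dK.d a = 0 ∧ algebraMap K L₁ a = x)
    (F₁ : Matrix (Fin n) (Fin n) L₁) (hF₁ : F₁.det ≠ 0)
    (hdF₁ : ∀ i j, d₁.d (F₁ i j) = (A.map (algebraMap K L₁) * F₁) i j)
    (F₂ : Matrix (Fin n) (Fin n) L₂) (hF₂ : F₂.det ≠ 0)
    (hdF₂ : ∀ i j, d₂.d (F₂ i j) = (A.map (algebraMap K L₂) * F₂) i j) :
    ∃ B : Matrix (Fin n) (Fin n) K, B.det ≠ 0 ∧ (∀ i j, dK.d (B i j) = 0) ∧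
      ∀ P : MvPolynomial (Fin n × Fin n) K,
        MvPolynomial.aeval (fun q ↦ F₂ q.1 q.2) P = 0 →
          MvPolynomial.aeval (fun q ↦ (F₁ * B.map (algebraMap K L₁)) q.1 q.2) P = 0 := by
  obtain ⟨M₁, _, _, _, _, g₁, hg₁⟩ := exists_isRealClosed_extension L₁
  obtain ⟨M₂, _, _, _, _, g₂, hg₂⟩ := exists_isRealClosed_extension L₂
  obtain ⟨_, _⟩ := IsRealClosed.exists_linearOrder k
  have hsign : ∀ a : K, SignType.sign ((g₂.comp (algebraMap K L₂)) a) =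
      SignType.sign ((g₁.comp (algebraMap K L₁)) a) := by
    intro a
    have e₁ := sign_map_eq_sign_map (f := RingHom.id L₁) hg₁ (algebraMap K L₁ a)
    have e₂ := sign_map_eq_sign_map (f := RingHom.id L₂) hg₂ (algebraMap K L₂ a)
    have e := sign_map_eq_sign_map (f := algebraMap K L₁) (g := algebraMap K L₂)
      (fun x ↦ (hord x).1) a
    exact e₂.symm.trans (e.symm.trans e₁)
  set I₂ : Set (MvPolynomial (Fin n × Fin n) K) :=
    {P | MvPolynomial.aeval (fun q ↦ F₂ q.1 q.2) P = 0} with hI₂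
  obtain ⟨ω, hω, hωI⟩ := IsRealClosed.exists_matrix_eval₂_eq_zero
    (g₂.comp (algebraMap K L₂)) (g₁.comp (algebraMap K L₁)) hsign (F₂.map g₂)
    (by rw [← RingHom.mapMatrix_apply, ← RingHom.map_det]; simpa using hF₂) I₂ (fun P hP ↦ by
      have h : g₂ (MvPolynomial.aeval (fun q ↦ F₂ q.1 q.2) P) = 0 := by
        rw [hI₂, Set.mem_ofPred_eq] at hP
        rw [hP, _root_.map_zero]
      rw [MvPolynomial.aeval_def, MvPolynomial.hom_eval₂] at h
      exact h)
  have hdet₁ : (F₁.map g₁).det ≠ 0 := by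
    rw [← RingHom.mapMatrix_apply, ← RingHom.map_det]; simpa using hF₁
  set E := (F₁.map g₁)⁻¹ * ω with hE
  have hFE : F₁.map g₁ * E = ω := by
    rw [hE, ← mul_assoc, Matrix.mul_nonsing_inv _ (isUnit_iff_ne_zero.2 hdet₁), one_mul]
  have hEdet : E.det ≠ 0 := fun h ↦ hω (by rw [← hFE, Matrix.det_mul, h, mul_zero])
  set W : Submodule L₁ (MvPolynomial (Fin n × Fin n) L₁) :=
    Submodule.span L₁ (F₁.mulGeneric '' I₂) with hW
  have hWd : ∀ v ∈ W, d₁.mapCoeff v ∈ W := by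
    intro v hv
    induction hv using Submodule.span_induction with
    | mem v hv =>
      obtain ⟨P, hP, rfl⟩ := hv
      obtain ⟨Q, hQ, hQ'⟩ := FieldDeriv.exists_deriv_polynomial dK d₁ d₂ hd₁ hd₂ A F₁ hdF₁ F₂ hdF₂ P
      rw [hQ']
      refine Submodule.subset_span ⟨Q, ?_, rfl⟩
      rw [hI₂, Set.mem_ofPred_eq] at hP ⊢
      rw [← hQ, hP, d₂.map_zero]
    | zero => rw [← zero_smul L₁ 0, d₁.mapCoeff_smul]; simp [d₁.map_zero]
    | add v w _ _ hv hw => rw [d₁.mapCoeff_add]; exact W.add_mem hv hw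
    | smul a v hv hdv =>
      rw [d₁.mapCoeff_smul]
      exact W.add_mem (W.smul_mem _ hdv) (W.smul_mem _ hv)
  have hWE : ∀ v ∈ W, v.eval₂ g₁ (fun q ↦ E q.1 q.2) = 0 := by
    intro v hv
    induction hv using Submodule.span_induction with
    | mem v hv =>
      obtain ⟨P, hP, rfl⟩ := hv
      rw [Matrix.eval₂_mulGeneric, hFE]
      exact hωI P hP
    | zero => exact MvPolynomial.eval₂_zero _ _
    | add v w _ _ hv hw => rw [MvPolynomial.eval₂_add, hv, hw, add_zero]
    | smul a v hv hdv =>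
      rw [MvPolynomial.smul_eq_C_mul, MvPolynomial.eval₂_mul, hdv, mul_zero]
  set θ : k →+* L₁ := (algebraMap K L₁).comp (algebraMap k K) with hθ
  obtain ⟨C, hC, hCJ⟩ := IsRealClosed.exists_matrix_eval₂_eq_zero (g₁.comp θ) (RingHom.id k)
    (fun a ↦ (sign_map_eq_sign_map (f := RingHom.id k) (g := g₁.comp θ) (fun x hx ↦ by
      obtain ⟨y, hy⟩ := IsSquare.of_nonneg (show (0 : k) ≤ x from hx)
      rw [hy, map_mul]
      exact mul_self_nonneg _) a).symm)
    E hEdet {v | MvPolynomial.map θ v ∈ W} (fun v hv ↦ by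
      rw [← MvPolynomial.eval₂_map]
      exact hWE _ hv)
  have hmapC : ((C.map (algebraMap k K)).map (algebraMap K L₁)) = C.map θ := by
    ext i j; simp [hθ]
  refine ⟨C.map (algebraMap k K), ?_, fun i j ↦ (hconst _).2 ⟨_, rfl⟩, fun P hP ↦ ?_⟩
  · rw [← RingHom.mapMatrix_apply, ← RingHom.map_det]; simpa using hC
  · have h1 : W ≤ LinearMap.ker (MvPolynomial.aeval (R := L₁)
        (fun q : Fin n × Fin n ↦ (C.map θ) q.1 q.2)).toLinearMap := by
      refine (d₁.le_span_constant_coeff W hWd).trans (Submodule.span_le.2 ?_)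
      rintro v ⟨hvW, hv⟩
      have hv' : v ∈ Set.range (MvPolynomial.map (σ := Fin n × Fin n) θ) := by
        refine MvPolynomial.mem_range_map_iff_coeffs_subset.2 fun x hx ↦ ?_
        obtain ⟨m, _, rfl⟩ := MvPolynomial.mem_coeffs_iff.1 hx
        obtain ⟨a, ha, hax⟩ := hc₁ _ (hv m)
        obtain ⟨b, rfl⟩ := (hconst a).1 ha
        exact ⟨b, hax⟩
      obtain ⟨v, rfl⟩ := hv'
      have h2 := congrArg θ (hCJ v hvW)
      rw [MvPolynomial.hom_eval₂, _root_.map_zero] at h2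
      change MvPolynomial.aeval _ (MvPolynomial.map θ v) = 0
      rw [MvPolynomial.aeval_def, MvPolynomial.eval₂_map]
      exact h2
    have h3 : (F₁.mulGeneric P).eval₂ (RingHom.id L₁) (fun q ↦ C.map θ q.1 q.2) = 0 :=
      h1 (Submodule.subset_span ⟨P, hP, rfl⟩)
    rw [Matrix.eval₂_mulGeneric] at h3
    rw [hmapC]
    simpa [MvPolynomial.aeval_def] using h3

section

variable {K L : Type} [Field K] [Field L] [Algebra K L] {n : ℕ}

/-- Multiplication of the generic matrix on the right by `B`. -/
noncomputable def Matrix.genericMul (B : Matrix (Fin n) (Fin n) K) :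
    MvPolynomial (Fin n × Fin n) K →ₐ[K] MvPolynomial (Fin n × Fin n) K :=
  MvPolynomial.aeval fun q ↦ ∑ l, MvPolynomial.X (q.1, l) * MvPolynomial.C (B l q.2)

theorem Matrix.aeval_genericMul (F : Matrix (Fin n) (Fin n) L) (B : Matrix (Fin n) (Fin n) K)
    (P : MvPolynomial (Fin n × Fin n) K) :
    MvPolynomial.aeval (fun q ↦ F q.1 q.2) (B.genericMul P) =
      MvPolynomial.aeval (fun q ↦ (F * B.map (algebraMap K L)) q.1 q.2) P := by
  have h : (MvPolynomial.aeval fun q ↦ F q.1 q.2).comp B.genericMul =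
      MvPolynomial.aeval (R := K) (fun q ↦ (F * B.map (algebraMap K L)) q.1 q.2) := by
    refine MvPolynomial.algHom_ext fun q ↦ ?_
    simp [Matrix.genericMul, Matrix.mul_apply]
  exact AlgHom.congr_fun h P

theorem Matrix.genericMul_genericMul (B C : Matrix (Fin n) (Fin n) K)
    (P : MvPolynomial (Fin n × Fin n) K) :
    B.genericMul (C.genericMul P) = (B * C).genericMul P := by
  have h : B.genericMul.comp C.genericMul = (B * C).genericMul := by
    refine MvPolynomial.algHom_ext fun q ↦ ?_
    simp only [Matrix.genericMul, AlgHom.comp_apply, MvPolynomial.aeval_X, map_sum, map_mul,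
      Matrix.mul_apply, Finset.mul_sum, Finset.sum_mul, mul_assoc]
    rw [Finset.sum_comm]
    refine Finset.sum_congr rfl fun i _ ↦ Finset.sum_congr rfl fun j _ ↦ ?_
    simp [MvPolynomial.algebraMap_eq]
  exact AlgHom.congr_fun h P

theorem Matrix.genericMul_one (P : MvPolynomial (Fin n × Fin n) K) :
    (1 : Matrix (Fin n) (Fin n) K).genericMul P = P := by
  have h : (1 : Matrix (Fin n) (Fin n) K).genericMul = AlgHom.id K _ := by
    refine MvPolynomial.algHom_ext fun q ↦ ?_
    simp [Matrix.genericMul, Matrix.one_apply]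
  exact AlgHom.congr_fun h P

theorem Ideal.comap_le_of_le_comap_of_surjective {R : Type*} [CommRing R] [IsNoetherianRing R]
    (f : R →+* R) (hf : Function.Surjective f) {I : Ideal R} (hI : I ≤ I.comap f) :
    I.comap f ≤ I := by
  obtain ⟨N, hN⟩ := monotone_stabilizes_iff_noetherian.2 (inferInstance : IsNoetherian R R)
    ⟨fun m ↦ (Ideal.comap f)^[m] I, monotone_nat_of_le_succ fun m ↦ by
      rw [Function.iterate_succ_apply]
      exact (Monotone.iterate (fun _ _ ↦ Ideal.comap_mono) m) hI⟩
  have h := hN (N + 1) N.le_succ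
  change (Ideal.comap f)^[N] I = (Ideal.comap f)^[N + 1] I at h
  rw [Function.iterate_succ_apply] at h
  exact ((Ideal.comap_injective_of_surjective f hf).iterate N h).ge

theorem Matrix.aeval_eq_zero_of_genericMul (F : Matrix (Fin n) (Fin n) L)
    (B : Matrix (Fin n) (Fin n) K) (hB : B.det ≠ 0)
    (h : ∀ P : MvPolynomial (Fin n × Fin n) K, MvPolynomial.aeval (fun q ↦ F q.1 q.2) P = 0 →
      MvPolynomial.aeval (fun q ↦ F q.1 q.2) (B.genericMul P) = 0)
    (P : MvPolynomial (Fin n × Fin n) K)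
    (hP : MvPolynomial.aeval (fun q ↦ F q.1 q.2) (B.genericMul P) = 0) :
    MvPolynomial.aeval (fun q ↦ F q.1 q.2) P = 0 := by
  have hsurj : Function.Surjective (B.genericMul : _ →+* MvPolynomial (Fin n × Fin n) K) :=
    fun P ↦ ⟨B⁻¹.genericMul P, by
      rw [RingHom.coe_coe, Matrix.genericMul_genericMul,
        Matrix.mul_nonsing_inv _ (isUnit_iff_ne_zero.2 hB), Matrix.genericMul_one]⟩
  set I := RingHom.ker (MvPolynomial.aeval (R := K) fun q : Fin n × Fin n ↦ F q.1 q.2) with hI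
  have hle : I ≤ I.comap (B.genericMul : _ →+* MvPolynomial (Fin n × Fin n) K) := fun P hP ↦ by
    rw [Ideal.mem_comap, RingHom.coe_coe, hI, RingHom.mem_ker]
    exact h P (RingHom.mem_ker.1 hP)
  have hP' : P ∈ I.comap (B.genericMul : _ →+* MvPolynomial (Fin n × Fin n) K) := by
    rwa [Ideal.mem_comap, RingHom.coe_coe, hI, RingHom.mem_ker]
  exact RingHom.mem_ker.1 (Ideal.comap_le_of_le_comap_of_surjective _ hsurj hle hP')

theorem exists_algEquiv_of_aeval_eq_zero_iff {ι L' : Type} [Field L'] [Algebra K L']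
    (x : ι → L) (y : ι → L') (hx : IntermediateField.adjoin K (Set.range x) = ⊤)
    (hy : IntermediateField.adjoin K (Set.range y) = ⊤)
    (h : ∀ P : MvPolynomial ι K, MvPolynomial.aeval x P = 0 ↔ MvPolynomial.aeval y P = 0) :
    ∃ φ : L ≃ₐ[K] L', ∀ i, φ (x i) = y i := by
  have hfrac : ∀ {E : Type} [Field E] [Algebra K E] (z : ι → E),
      IntermediateField.adjoin K (Set.range z) = ⊤ →
      IsFractionRing (MvPolynomial.aeval (R := K) z).range E := by
    intro E _ _ z hz
    refine IsFractionRing.of_field _ _ fun w ↦ ?_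
    obtain ⟨P, Q, hPQ⟩ := (IntermediateField.mem_adjoin_range_iff K z w).1 (hz ▸ trivial)
    exact ⟨⟨_, P, rfl⟩, ⟨_, Q, rfl⟩, hPQ⟩
  have := hfrac x hx
  have := hfrac y hy
  have hker : RingHom.ker (MvPolynomial.aeval (R := K) x) =
      RingHom.ker (MvPolynomial.aeval (R := K) y) := Ideal.ext h
  let e : (MvPolynomial.aeval (R := K) x).range ≃ₐ[K] (MvPolynomial.aeval (R := K) y).range :=
    (Ideal.quotientKerEquivRange _).symm.trans
      ((Ideal.quotientEquivAlgOfEq K hker).trans (Ideal.quotientKerEquivRange _))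
  have he : ∀ P, e ⟨MvPolynomial.aeval x P, P, rfl⟩ = ⟨MvPolynomial.aeval y P, P, rfl⟩ := by
    intro P
    have h1 : (Ideal.quotientKerEquivRange (MvPolynomial.aeval (R := K) x)).symm
        ⟨MvPolynomial.aeval x P, P, rfl⟩ = Ideal.Quotient.mk _ P := by
      rw [AlgEquiv.symm_apply_eq]
      rfl
    simp only [e, AlgEquiv.trans_apply, h1]
    rfl
  refine ⟨IsFractionRing.algEquivOfAlgEquiv e, fun i ↦ ?_⟩
  have h1 := IsFractionRing.algEquivOfAlgEquiv_algebraMap (K := L) (L := L') e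
    ⟨MvPolynomial.aeval x (MvPolynomial.X i), _, rfl⟩
  rw [he] at h1
  simpa [Subalgebra.algebraMap_def] using h1

theorem FieldDeriv.algEquiv_comm {L' : Type} [Field L'] [Algebra K L'] (dK : FieldDeriv K)
    (d : FieldDeriv L) (d' : FieldDeriv L')
    (hd : ∀ a, d.d (algebraMap K L a) = algebraMap K L (dK.d a))
    (hd' : ∀ a, d'.d (algebraMap K L' a) = algebraMap K L' (dK.d a))
    (φ : L ≃ₐ[K] L') {s : Set L} (hs : IntermediateField.adjoin K s = ⊤)
    (h : ∀ x ∈ s, φ (d.d x) = d'.d (φ x)) (x : L) : φ (d.d x) = d'.d (φ x) := by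
  have hx : x ∈ IntermediateField.adjoin K s := hs ▸ trivial
  induction hx using IntermediateField.adjoin_induction with
  | mem x hx => exact h x hx
  | algebraMap a => rw [hd, φ.commutes, φ.commutes, hd']
  | add x y _ _ hx hy => rw [d.map_add, _root_.map_add, hx, hy, _root_.map_add, d'.map_add]
  | inv x _ hx =>
    rw [d.map_inv, map_inv₀, d'.map_inv, ← hx, _root_.map_mul, _root_.map_mul, map_neg, map_inv₀]
  | mul x y _ _ hx hy =>
    rw [d.leibniz, _root_.map_add, _root_.map_mul, _root_.map_mul, hx, hy, _root_.map_mul,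
      d'.leibniz]

end

end

/-- Unicity of real Picard--Vessiot fields: if two real Picard--Vessiot
fields `L₁` and `L₂` for `y' = A y` over a real differential field `K` (with real closed
field of constants `k ≠ K`) admit orderings inducing the same ordering on `K`, then `L₁`
and `L₂` are isomorphic as differential field extensions of `K`. -/
theorem real_picard_vessiot_unique
    (K : Type) [Field K] [CharZero K] (dK : FieldDeriv K)
    (hKreal : IsFormallyRealField K)
    (k : Type) [Field k] [Algebra k K]
    (hconst : ∀ a : K, dK.d a = 0 ↔ a ∈ Set.range (algebraMap k K))
    (hkrc : IsRealClosedField k)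
    (hkK : ∃ a : K, dK.d a ≠ 0)
    (n : ℕ) (A : Matrix (Fin n) (Fin n) K)
    (L₁ L₂ : Type) [Field L₁] [Field L₂] [Algebra K L₁] [Algebra K L₂]
    (d₁ : FieldDeriv L₁) (d₂ : FieldDeriv L₂)
    (hPV₁ : IsPicardVessiot dK d₁ A) (hreal₁ : IsFormallyRealField L₁)
    (hPV₂ : IsPicardVessiot dK d₂ A) (hreal₂ : IsFormallyRealField L₂)
    (τ₁ : FieldOrdering L₁) (τ₂ : FieldOrdering L₂)
    (hττ : (algebraMap K L₁) ⁻¹' τ₁.P = (algebraMap K L₂) ⁻¹' τ₂.P) :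
    ∃ φ : L₁ ≃ₐ[K] L₂, ∀ x : L₁, φ (d₁.d x) = d₂.d (φ x) := by
  have := hkrc.isRealClosed
  obtain ⟨_, _, hτ₁⟩ := τ₁.exists_linearOrder
  obtain ⟨_, _, hτ₂⟩ := τ₂.exists_linearOrder
  have hord : ∀ a : K, 0 ≤ algebraMap K L₁ a ↔ 0 ≤ algebraMap K L₂ a := fun a ↦ by
    rw [hτ₁, hτ₂]
    exact Set.ext_iff.1 hττ a
  obtain ⟨hd₁, F₁, hF₁, hdF₁, hgen₁, hc₁⟩ := hPV₁
  obtain ⟨hd₂, F₂, hF₂, hdF₂, hgen₂, hc₂⟩ := hPV₂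
  rw [isUnit_iff_ne_zero] at hF₁ hF₂
  obtain ⟨B, hB, hdB, hBI⟩ := FieldDeriv.exists_const_matrix dK hconst A hord d₁ d₂ hd₁ hd₂ hc₁
    F₁ hF₁ hdF₁ F₂ hF₂ hdF₂
  obtain ⟨C, hC, hdC, hCI⟩ := FieldDeriv.exists_const_matrix dK hconst A (fun a ↦ (hord a).symm)
    d₂ d₁ hd₂ hd₁ hc₂ F₂ hF₂ hdF₂ F₁ hF₁ hdF₁
  set G := F₁ * B.map (algebraMap K L₁) with hG
  have hback : ∀ P : MvPolynomial (Fin n × Fin n) K,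
      MvPolynomial.aeval (fun q ↦ G q.1 q.2) P = 0 →
        MvPolynomial.aeval (fun q ↦ F₂ q.1 q.2) ((C * B).genericMul P) = 0 := fun P hP ↦ by
    rw [hG, ← Matrix.aeval_genericMul] at hP
    have h := hCI _ hP
    rwa [← Matrix.aeval_genericMul, Matrix.genericMul_genericMul] at h
  have hker : ∀ P : MvPolynomial (Fin n × Fin n) K,
      MvPolynomial.aeval (fun q ↦ G q.1 q.2) P = 0 ↔
        MvPolynomial.aeval (fun q ↦ F₂ q.1 q.2) P = 0 := fun P ↦
    ⟨fun hP ↦ F₂.aeval_eq_zero_of_genericMul (C * B)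
      (by rw [Matrix.det_mul]; exact mul_ne_zero hC hB) (fun P hP ↦ hback P (hBI P hP)) P
      (hback P hP), hBI P⟩
  have hF₁G : F₁ = G * B⁻¹.map (algebraMap K L₁) := by
    rw [hG, mul_assoc, ← Matrix.map_mul, Matrix.mul_nonsing_inv _ (isUnit_iff_ne_zero.2 hB)]
    simp
  have hgenG : IntermediateField.adjoin K (Set.range fun q : Fin n × Fin n ↦ G q.1 q.2) = ⊤ := by
    rw [eq_top_iff, ← hgen₁, IntermediateField.adjoin_le_iff]
    rintro _ ⟨q, rfl⟩
    change F₁ q.1 q.2 ∈ IntermediateField.adjoin K _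
    rw [hF₁G, Matrix.mul_apply]
    exact sum_mem fun l _ ↦ mul_mem
      (IntermediateField.subset_adjoin K _ ⟨(q.1, l), rfl⟩)
      (IntermediateField.algebraMap_mem _ _)
  have hdG : ∀ i j, d₁.d (G i j) = (A.map (algebraMap K L₁) * G) i j := fun i j ↦ by
    have h : ∀ l, d₁.d (F₁ i l * algebraMap K L₁ (B l j)) =
        (A.map (algebraMap K L₁) * F₁) i l * algebraMap K L₁ (B l j) := fun l ↦ by
      rw [d₁.leibniz, hd₁, hdB, map_zero, mul_zero, zero_add, hdF₁]
    rw [hG, ← mul_assoc, Matrix.mul_apply, Matrix.mul_apply, d₁.map_sum]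
    exact Finset.sum_congr rfl fun l _ ↦ h l
  obtain ⟨φ, hφ⟩ := exists_algEquiv_of_aeval_eq_zero_iff _ _ hgenG hgen₂ hker
  refine ⟨φ, FieldDeriv.algEquiv_comm dK d₁ d₂ hd₁ hd₂ φ hgenG ?_⟩
  rintro _ ⟨q, rfl⟩
  have hφ' : ∀ i j, φ (G i j) = F₂ i j := fun i j ↦ hφ (i, j)
  simp [hdG, hdF₂, hφ', Matrix.mul_apply]
end

section
/- Fix a prime p and let K = ℚ_p(z) be the rational function field over the p-adic numbers with the derivation determined by z′ = 1. Let a ∈ ℤ_p be a unit whose image in 𝔽_p is not a square. For j = 1, 2, 3, 4 let L_j = K(t_j), where t₁² = z, t₂² = pz, t₃² = az, t₄² = paz, each equipped with the unique derivation extending that of K. Then each L_j is a p-adic Picard–Vessiot field for the equation y′ = (1/(2z)) y over K, and the L_j are pairwise non-isomorphic as differential field extensions of K. -/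
/-- A valuation subring `O` of `F` witnesses that `F` is a p-adic field if `pO` is the
maximal ideal of `O` and `O/pO ≅ 𝔽_p`. -/
def PAdicWitness (p : ℕ) {F : Type} [Field F] (O : ValuationSubring F) : Prop :=
  (Ideal.span {(p : O)}).IsMaximal ∧
    Nonempty ((O ⧸ (Ideal.span {(p : O)} : Ideal O)) ≃+* ZMod p)

/-- A field is p-adic if it admits a valuation subring witnessing this. -/
def IsPAdicField (p : ℕ) (F : Type) [Field F] : Prop :=
  ∃ O : ValuationSubring F, PAdicWitness p O

/-- There is no isomorphism of differential field extensions of `K` from `L` to `M`. -/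
def NoDiffIso (K : Type) [Field K] (L M : Type) [Field L] [Field M]
    [Algebra K L] [Algebra K M] (dL : FieldDeriv L) (dM : FieldDeriv M) : Prop :=
  ¬ ∃ φ : L ≃ₐ[K] M, ∀ x : L, φ (dL.d x) = dM.d (φ x)

open Polynomial in
/-- A rational function over a field of characteristic zero that is killed by a derivation
not killing the variable is constant. -/
theorem RatFunc.exists_eq_C_of_derivation_eq_zero {k : Type} [Field k] [CharZero k]
    (D : Derivation k (RatFunc k) (RatFunc k)) (hD : D RatFunc.X ≠ 0) (f : RatFunc k)
    (hf : D f = 0) : ∃ r : k, f = RatFunc.C r := by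
  have hpoly (P : k[X]) : D (algebraMap k[X] (RatFunc k) P)
      = algebraMap k[X] (RatFunc k) (derivative P) * D RatFunc.X := by
    rw [← RatFunc.aeval_X_left_eq_algebraMap, ← RatFunc.aeval_X_left_eq_algebraMap,
      D.map_aeval, smul_eq_mul]
  have hden : algebraMap k[X] (RatFunc k) f.denom ≠ 0 :=
    RatFunc.algebraMap_ne_zero f.denom_ne_zero
  have hmul : algebraMap k[X] (RatFunc k) f.num = f * algebraMap k[X] (RatFunc k) f.denom := by
    rw [← div_eq_iff hden, f.num_div_denom]
  have hder : derivative f.num * f.denom = f.num * derivative f.denom := by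
    apply RatFunc.algebraMap_injective k
    have h := congrArg D hmul
    rw [D.leibniz, hf, hpoly, hpoly, smul_zero, add_zero, smul_eq_mul, ← mul_assoc] at h
    rw [map_mul, map_mul, mul_right_cancel₀ hD h, hmul]
    ring
  have hconst : derivative f.denom = 0 := by
    by_contra h
    have hdvd : f.denom ∣ derivative f.denom :=
      f.isCoprime_num_denom.symm.dvd_of_dvd_mul_left (hder ▸ dvd_mul_left _ _)
    exact absurd (degree_le_of_dvd hdvd h) (not_le.2 (degree_derivative_lt f.denom_ne_zero))
  have hnum : derivative f.num = 0 := by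
    rw [hconst, mul_zero] at hder
    exact (mul_eq_zero.1 hder).resolve_right f.denom_ne_zero
  obtain ⟨u, hu⟩ := natDegree_eq_zero.1 (derivative_eq_zero.1 hnum)
  obtain ⟨v, hv⟩ := natDegree_eq_zero.1 (derivative_eq_zero.1 hconst)
  refine ⟨u / v, ?_⟩
  rw [← f.num_div_denom, ← hu, ← hv, RatFunc.algebraMap_C, RatFunc.algebraMap_C, map_div₀]

/-- A constant that is a square of a rational function is a square of a constant. -/
theorem RatFunc.isSquare_of_sq_eq_C {k : Type} [Field k] {w : RatFunc k} {d : k}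
    (h : w ^ 2 = RatFunc.C d) : IsSquare d := by
  by_cases hw : ∃ c, w = RatFunc.C c
  · obtain ⟨c, rfl⟩ := hw
    rw [← map_pow] at h
    exact ⟨c, by rw [← sq]; exact (RatFunc.C_injective h).symm⟩
  · refine absurd ?_ (RatFunc.transcendental_of_ne_C w hw)
    refine IsAlgebraic.of_pow two_pos ?_
    rw [h, ← RatFunc.algebraMap_eq_C]
    exact isAlgebraic_algebraMap d

/-- A valuation subring with a residue map to `ZMod p` whose kernel is generated by `p`
witnesses that the field is p-adic. -/
theorem PAdicWitness.of_residue_map {p : ℕ} [Fact p.Prime] {F : Type} [Field F]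
    {O : ValuationSubring F} (φ : O →+* ZMod p) (h : ∀ x, φ x = 0 → (p : O) ∣ x) :
    PAdicWitness p O := by
  have hker : RingHom.ker φ = Ideal.span {(p : O)} := by
    ext x
    rw [RingHom.mem_ker, Ideal.mem_span_singleton]
    refine ⟨h x, ?_⟩
    rintro ⟨y, rfl⟩
    simp
  have hφ := ZMod.ringHom_surjective φ
  refine ⟨hker ▸ RingHom.ker_isMaximal_of_surjective φ hφ, ⟨?_⟩⟩
  exact (Ideal.quotEquivOfEq hker.symm).trans (RingHom.quotientKerEquivOfSurjective hφ)

/-- Being a p-adic field is invariant under ring isomorphism. -/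
theorem IsPAdicField.of_ringEquiv {p : ℕ} [Fact p.Prime] {F G : Type} [Field F] [Field G]
    (e : F ≃+* G) (h : IsPAdicField p F) : IsPAdicField p G := by
  obtain ⟨O, -, ⟨ψ⟩⟩ := h
  let σ : O.comap e.symm.toRingHom →+* O :=
    (e.symm.toRingHom.comp (O.comap e.symm.toRingHom).subtype).codRestrict O.toSubring
      fun x => x.2
  refine ⟨O.comap e.symm.toRingHom, PAdicWitness.of_residue_map
    ((ψ.toRingHom.comp (Ideal.Quotient.mk _)).comp σ) fun x hx => ?_⟩
  have hx' : σ x ∈ Ideal.span {(p : O)} :=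
    Ideal.Quotient.eq_zero_iff_mem.1 (ψ.injective (hx.trans (map_zero ψ).symm))
  obtain ⟨y, hy⟩ := Ideal.mem_span_singleton.1 hx'
  have hy' : e.symm x = p * (y : F) := congrArg Subtype.val hy
  refine ⟨⟨e y, by simp [ValuationSubring.mem_comap]⟩, Subtype.ext ?_⟩
  change (x : G) = p * e y
  simpa using congrArg e hy'

namespace RatFunc

variable {k : Type} [Field k]

/-- A rational function is regular at `0` if its reduced denominator does not vanish there. -/
def RegularAtZero (f : RatFunc k) : Prop :=
  Polynomial.eval₂ (RingHom.id k) 0 f.denom ≠ 0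

theorem RegularAtZero.of_denom_dvd {f : RatFunc k} {Q : Polynomial k} (h : f.denom ∣ Q)
    (hQ : Polynomial.eval₂ (RingHom.id k) 0 Q ≠ 0) : RegularAtZero f := by
  obtain ⟨R, rfl⟩ := h
  rw [Polynomial.eval₂_mul] at hQ
  exact left_ne_zero_of_mul hQ

theorem RegularAtZero.mul {f g : RatFunc k} (hf : RegularAtZero f) (hg : RegularAtZero g) :
    RegularAtZero (f * g) :=
  .of_denom_dvd (denom_mul_dvd f g) (by rw [Polynomial.eval₂_mul]; exact mul_ne_zero hf hg)

theorem RegularAtZero.add {f g : RatFunc k} (hf : RegularAtZero f) (hg : RegularAtZero g) :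
    RegularAtZero (f + g) :=
  .of_denom_dvd (denom_add_dvd f g) (by rw [Polynomial.eval₂_mul]; exact mul_ne_zero hf hg)

theorem regularAtZero_C (c : k) : RegularAtZero (C c) := by
  simp [RegularAtZero]

theorem eval_zero_eq_div (f : RatFunc k) : f.eval (RingHom.id k) 0 =
    Polynomial.eval₂ (RingHom.id k) 0 f.num / Polynomial.eval₂ (RingHom.id k) 0 f.denom := rfl

theorem regularAtZero_inv {f : RatFunc k}
    (h : Polynomial.eval₂ (RingHom.id k) 0 f.num ≠ 0) : RegularAtZero f⁻¹ := by
  refine .of_denom_dvd (denom_inv_dvd ?_) h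
  rintro rfl
  simp at h

theorem regularAtZero_or_inv (f : RatFunc k) :
    RegularAtZero f ∨ (RegularAtZero f⁻¹ ∧ f⁻¹.eval (RingHom.id k) 0 = 0) := by
  by_cases hf : RegularAtZero f
  · exact .inl hf
  have hden : Polynomial.eval₂ (RingHom.id k) 0 f.denom = 0 := not_not.1 hf
  have hnum : Polynomial.eval₂ (RingHom.id k) 0 f.num ≠ 0 := by
    intro hnum
    obtain ⟨u, v, huv⟩ := f.isCoprime_num_denom
    simpa [Polynomial.eval₂_add, Polynomial.eval₂_mul, hnum, hden] using
      congrArg (Polynomial.eval₂ (RingHom.id k) 0) huv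
  have hf0 : f ≠ 0 := by
    rintro rfl
    simp at hnum
  refine .inr ⟨regularAtZero_inv hnum, ?_⟩
  obtain ⟨R, hR⟩ := (associated_num_inv hf0).symm.dvd
  rw [eval_zero_eq_div, hR, Polynomial.eval₂_mul, hden, zero_mul, zero_div]

end RatFunc

/-- The rational functions that are regular at `0` with `p`-adically integral value there. -/
noncomputable def RatFunc.integralAtZero (p : ℕ) [Fact p.Prime] :
    ValuationSubring (RatFunc ℚ_[p]) where
  carrier := {f | f.RegularAtZero ∧ ‖f.eval (RingHom.id ℚ_[p]) 0‖ ≤ 1}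
  zero_mem' := ⟨by simpa using RatFunc.regularAtZero_C (0 : ℚ_[p]), by simp⟩
  one_mem' := ⟨by simpa using RatFunc.regularAtZero_C (1 : ℚ_[p]), by simp⟩
  add_mem' {f g} hf hg := ⟨hf.1.add hg.1, by
    rw [RatFunc.eval_add _ _ hf.1 hg.1]
    exact (Padic.nonarchimedean _ _).trans (max_le hf.2 hg.2)⟩
  mul_mem' {f g} hf hg := ⟨hf.1.mul hg.1, by
    rw [RatFunc.eval_mul _ _ hf.1 hg.1, norm_mul]
    exact mul_le_one₀ hf.2 (norm_nonneg _) hg.2⟩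
  neg_mem' {f} hf := by
    have h := RatFunc.regularAtZero_C (-1 : ℚ_[p])
    have hneg : -f = RatFunc.C (-1) * f := by simp
    rw [hneg]
    refine ⟨h.mul hf.1, ?_⟩
    rw [RatFunc.eval_mul _ _ h hf.1, norm_mul, RatFunc.eval_C, RingHom.id_apply, norm_neg,
      norm_one, one_mul]
    exact hf.2
  mem_or_inv_mem' f := by
    rcases f.regularAtZero_or_inv with h | ⟨h, h0⟩
    · by_cases hle : ‖f.eval (RingHom.id ℚ_[p]) 0‖ ≤ 1
      · exact .inl ⟨h, hle⟩
      · have hne : f.eval (RingHom.id ℚ_[p]) 0 ≠ 0 := by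
          intro h0
          simp [h0] at hle
        have hinv : f⁻¹.RegularAtZero :=
          RatFunc.regularAtZero_inv (left_ne_zero_of_mul (by
            rwa [RatFunc.eval_zero_eq_div, div_eq_mul_inv] at hne))
        refine .inr ⟨hinv, ?_⟩
        have hf0 : f ≠ 0 := by
          rintro rfl
          simp at hne
        have hmul := RatFunc.eval_mul _ _ h hinv
        rw [mul_inv_cancel₀ hf0, RatFunc.eval_one] at hmul
        rw [eq_inv_of_mul_eq_one_right hmul.symm, norm_inv]
        exact inv_le_one_of_one_le₀ (not_le.1 hle).le
    · exact .inr ⟨h, by simp [h0]⟩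

theorem RatFunc.isPAdicField (p : ℕ) [Fact p.Prime] : IsPAdicField p (RatFunc ℚ_[p]) := by
  let v : RatFunc.integralAtZero p →+* ℤ_[p] :=
    { toFun := fun f => ⟨f.1.eval (RingHom.id ℚ_[p]) 0, f.2.2⟩
      map_zero' := Subtype.ext (RatFunc.eval_zero _ _)
      map_one' := Subtype.ext (RatFunc.eval_one _ _)
      map_add' := fun f g => Subtype.ext (RatFunc.eval_add _ _ f.2.1 g.2.1)
      map_mul' := fun f g => Subtype.ext (RatFunc.eval_mul _ _ f.2.1 g.2.1) }
  refine ⟨RatFunc.integralAtZero p, .of_residue_map (PadicInt.toZMod.comp v) fun f hf => ?_⟩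
  have hp : (p : ℚ_[p]) ≠ 0 := by exact_mod_cast (Fact.out : p.Prime).ne_zero
  have hmem : v f ∈ RingHom.ker (PadicInt.toZMod (p := p)) := hf
  rw [PadicInt.ker_toZMod, PadicInt.maximalIdeal_eq_span_p, Ideal.mem_span_singleton] at hmem
  obtain ⟨y, hy⟩ := hmem
  have hy' : f.1.eval (RingHom.id ℚ_[p]) 0 = p * y := congrArg Subtype.val hy
  have hC := RatFunc.regularAtZero_C (p : ℚ_[p])⁻¹
  refine ⟨⟨RatFunc.C (p : ℚ_[p])⁻¹ * f.1, hC.mul f.2.1, ?_⟩, Subtype.ext ?_⟩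
  · rw [RatFunc.eval_mul _ _ hC f.2.1, RatFunc.eval_C, hy', RingHom.id_apply,
      inv_mul_cancel_left₀ hp]
    exact y.2
  · have hp' : (p : RatFunc ℚ_[p]) ≠ 0 := by
      rw [← map_natCast (RatFunc.C (K := ℚ_[p]))]
      exact (map_ne_zero _).2 hp
    simp [hp']

section SqrtExtension

variable {k L : Type} [Field k] [Field L] [Algebra (RatFunc k) L] [Algebra k L]
  [IsScalarTower k (RatFunc k) L]

open IntermediateField in
/-- The field obtained from `k(z)` by adjoining `t = √(cz)` is the rational function field
in `t`. -/
theorem exists_ratFunc_algEquiv_of_sq {c : k} (hc : c ≠ 0) {t : L}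
    (ht : t ^ 2 = algebraMap (RatFunc k) L (RatFunc.C c * RatFunc.X))
    (hgen : IntermediateField.adjoin (RatFunc k) ({t} : Set L) = ⊤) :
    ∃ e : RatFunc k ≃ₐ[k] L, e RatFunc.X = t := by
  have hX : algebraMap (RatFunc k) L RatFunc.X = algebraMap k L c⁻¹ * t ^ 2 := by
    rw [ht, IsScalarTower.algebraMap_apply k (RatFunc k) L, RatFunc.algebraMap_eq_C, ← map_mul,
      ← mul_assoc, ← map_mul, inv_mul_cancel₀ hc, map_one, one_mul]
  have htr : Transcendental k t := by
    intro h
    have hX' : IsAlgebraic k (algebraMap (RatFunc k) L RatFunc.X) := by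
      rw [hX]
      exact (isAlgebraic_algebraMap _).mul (h.pow 2)
    exact RatFunc.transcendental_X
      ((isAlgebraic_algebraMap_iff (algebraMap (RatFunc k) L).injective).1 hX')
  have htop : k⟮t⟯ = ⊤ := by
    have htm : t ∈ k⟮t⟯ := mem_adjoin_simple_self k t
    have hXm : algebraMap (RatFunc k) L RatFunc.X ∈ k⟮t⟯ :=
      hX ▸ mul_mem (k⟮t⟯.algebraMap_mem _) (pow_mem htm 2)
    have hP (P : Polynomial k) :
        algebraMap (RatFunc k) L (algebraMap (Polynomial k) (RatFunc k) P) ∈ k⟮t⟯ := by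
      rw [← RatFunc.aeval_X_left_eq_algebraMap, ← Polynomial.aeval_algebraMap_apply]
      rw [show algebraMap (RatFunc k) L RatFunc.X = ((⟨_, hXm⟩ : k⟮t⟯) : L) from rfl,
        IntermediateField.aeval_coe]
      exact SetLike.coe_mem _
    have hK (f : RatFunc k) : algebraMap (RatFunc k) L f ∈ k⟮t⟯ := by
      rw [← f.num_div_denom, map_div₀]
      exact div_mem (hP _) (hP _)
    rw [eq_top_iff]
    intro x _
    have hle : adjoin (RatFunc k) ({t} : Set L) ≤ k⟮t⟯.toSubfield.toIntermediateField hK :=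
      adjoin_le_iff.2 (Set.singleton_subset_iff.2 htm)
    exact hle (hgen ▸ mem_top)
  refine ⟨(RatFunc.algEquivOfTranscendental t htr).trans
    ((equivOfEq htop).trans topEquiv), ?_⟩
  simp [RatFunc.algEquivOfTranscendental_X]

end SqrtExtension

/-- A field derivation vanishing on the image of `k`, as a `k`-linear derivation. -/
def FieldDeriv.toDerivation {k F : Type} [Field k] [Field F] [Algebra k F] (δ : FieldDeriv F)
    (h : ∀ r : k, δ.d (algebraMap k F r) = 0) : Derivation k F F :=
  Derivation.mk'
    { toFun := δ.d
      map_add' := δ.map_add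
      map_smul' := fun r x => by
        simp [Algebra.smul_def, δ.leibniz, h] }
    fun x y => by
      simp [δ.leibniz, mul_comm]

/-- Transport of a field derivation along a ring isomorphism. -/
def FieldDeriv.transport {E F : Type} [Field E] [Field F] (e : E ≃+* F) (δ : FieldDeriv F) :
    FieldDeriv E where
  d x := e.symm (δ.d (e x))
  map_add x y := by simp [δ.map_add]
  leibniz x y := by simp [δ.leibniz]

section SqrtPicardVessiot

variable {k L : Type} [Field k] [Field L] [Algebra (RatFunc k) L]

theorem exists_ratFunc_ringEquiv_of_sq {c : k} (hc : c ≠ 0) {t : L}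
    (ht : t ^ 2 = algebraMap (RatFunc k) L (RatFunc.C c * RatFunc.X))
    (hgen : IntermediateField.adjoin (RatFunc k) ({t} : Set L) = ⊤) :
    ∃ e : RatFunc k ≃+* L, e RatFunc.X = t ∧
      ∀ r : k, e (RatFunc.C r) = algebraMap (RatFunc k) L (RatFunc.C r) := by
  let _ : Algebra k L := Algebra.compHom L (algebraMap k (RatFunc k))
  have : IsScalarTower k (RatFunc k) L := .of_algebraMap_eq fun _ => rfl
  obtain ⟨e, he⟩ := exists_ratFunc_algEquiv_of_sq hc ht hgen
  exact ⟨e.toRingEquiv, he, e.commutes⟩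

/-- The field `k(z)(√(cz))` is a Picard--Vessiot field for `y' = (1/(2z)) y`. -/
theorem isPicardVessiot_of_sq [CharZero k] {c : k} (hc : c ≠ 0) {t : L}
    (ht : t ^ 2 = algebraMap (RatFunc k) L (RatFunc.C c * RatFunc.X))
    (hgen : IntermediateField.adjoin (RatFunc k) ({t} : Set L) = ⊤)
    {dK : FieldDeriv (RatFunc k)} {dL : FieldDeriv L}
    (hdC : ∀ r : k, dK.d (algebraMap k (RatFunc k) r) = 0) (hdX : dK.d RatFunc.X = 1)
    (hd : ∀ x, dL.d (algebraMap (RatFunc k) L x) = algebraMap (RatFunc k) L (dK.d x)) :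
    IsPicardVessiot dK dL
      (Matrix.of fun _ _ : Fin 1 => (2 * RatFunc.X : RatFunc k)⁻¹) := by
  rw [RatFunc.algebraMap_eq_C] at hdC
  obtain ⟨e, he, heC⟩ := exists_ratFunc_ringEquiv_of_sq hc ht hgen
  have : CharZero L := charZero_of_injective_algebraMap (algebraMap (RatFunc k) L).injective
  set z : L := algebraMap (RatFunc k) L RatFunc.X with hz
  set c' : L := algebraMap (RatFunc k) L (RatFunc.C c) with hc'
  have hz0 : z ≠ 0 := (map_ne_zero _).2 RatFunc.X_ne_zero
  have hc0 : c' ≠ 0 := (map_ne_zero _).2 ((map_ne_zero _).2 hc)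
  have htz : t ^ 2 = c' * z := by rw [ht, map_mul]
  have ht0 : t ≠ 0 := by
    rintro rfl
    exact mul_ne_zero hc0 hz0 (by rw [← htz]; simp)
  have hdt : 2 * t * dL.d t = c' := by
    have h : dL.d (t ^ 2) = c' := by
      rw [ht, hd, dK.leibniz, hdC, hdX, mul_one, zero_mul, add_zero]
    rw [← h, sq, dL.leibniz]
    ring
  have hsol : dL.d t = (2 * z)⁻¹ * t := by
    field_simp
    apply mul_left_cancel₀ ht0
    linear_combination z * hdt - htz
  refine ⟨hd, Matrix.of fun _ _ => t, ?_, ?_, ?_, ?_⟩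
  · simpa using ht0
  · intro i j
    have h2 : algebraMap (RatFunc k) L 2 = 2 := map_ofNat _ 2
    simp [Matrix.mul_apply, hsol, hz, h2]
  · simpa [Set.range_const] using hgen
  · intro x hx
    let D := (dL.transport e).toDerivation (k := k) fun r => by
      simp [FieldDeriv.transport, RatFunc.algebraMap_eq_C, heC, hd, hdC]
    have hDX : D RatFunc.X ≠ 0 := by
      change e.symm (dL.d (e RatFunc.X)) ≠ 0
      rw [he, hsol, map_ne_zero_iff _ e.symm.injective]
      exact mul_ne_zero (inv_ne_zero (mul_ne_zero two_ne_zero hz0)) ht0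
    have hDx : D (e.symm x) = 0 := by
      change e.symm (dL.d (e (e.symm x))) = 0
      rw [e.apply_symm_apply, hx, map_zero]
    obtain ⟨r, hr⟩ := RatFunc.exists_eq_C_of_derivation_eq_zero D hDX _ hDx
    exact ⟨RatFunc.C r, hdC r, by rw [← heC, ← hr, e.apply_symm_apply]⟩

/-- The field `ℚ_p(z)(√(cz))` is a p-adic field. -/
theorem isPAdicField_of_sq {p : ℕ} [Fact p.Prime] {F : Type} [Field F]
    [Algebra (RatFunc ℚ_[p]) F] {c : ℚ_[p]} (hc : c ≠ 0) {t : F}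
    (ht : t ^ 2 = algebraMap (RatFunc ℚ_[p]) F (RatFunc.C c * RatFunc.X))
    (hgen : IntermediateField.adjoin (RatFunc ℚ_[p]) ({t} : Set F) = ⊤) :
    IsPAdicField p F := by
  obtain ⟨e, -⟩ := exists_ratFunc_ringEquiv_of_sq hc ht hgen
  exact (RatFunc.isPAdicField p).of_ringEquiv e

/-- If `bc` is not a square in `k`, then `k(z)(√(bz))` and `k(z)(√(cz))` are not isomorphic
over `k(z)`. -/
theorem noDiffIso_of_not_isSquare {M : Type} [Field M] [Algebra (RatFunc k) M]
    {b c : k} (hc : c ≠ 0) {t : L} {u : M}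
    (ht : t ^ 2 = algebraMap (RatFunc k) L (RatFunc.C b * RatFunc.X))
    (hu : u ^ 2 = algebraMap (RatFunc k) M (RatFunc.C c * RatFunc.X))
    (hgen : IntermediateField.adjoin (RatFunc k) ({u} : Set M) = ⊤)
    (hbc : ¬ IsSquare (b * c)) (dL : FieldDeriv L) (dM : FieldDeriv M) :
    NoDiffIso (RatFunc k) L M dL dM := by
  rintro ⟨φ, -⟩
  obtain ⟨e, -, heC⟩ := exists_ratFunc_ringEquiv_of_sq hc hu hgen
  have hX : algebraMap (RatFunc k) M RatFunc.X ≠ 0 := (map_ne_zero _).2 RatFunc.X_ne_zero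
  have hc' : algebraMap (RatFunc k) M (RatFunc.C c) ≠ 0 :=
    (map_ne_zero _).2 ((map_ne_zero _).2 hc)
  have hφt : φ t ^ 2 = algebraMap (RatFunc k) M (RatFunc.C b * RatFunc.X) := by
    rw [← map_pow, ht, φ.commutes]
  have hsq : (φ t / u) ^ 2 = e (RatFunc.C (b / c)) := by
    rw [heC, div_pow, hφt, hu, map_div₀, map_div₀, map_mul, map_mul, mul_div_mul_right _ _ hX]
  have hw : (e.symm (φ t / u)) ^ 2 = RatFunc.C (b / c) := by
    rw [← map_pow, hsq, e.symm_apply_apply]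
  obtain ⟨r, hr⟩ := RatFunc.isSquare_of_sq_eq_C hw
  refine hbc ⟨r * c, ?_⟩
  rw [mul_mul_mul_comm, ← hr]
  field_simp

end SqrtPicardVessiot

/-- A `p`-adic number of the form `pu` with `‖u‖ = 1` is not a square. -/
theorem Padic.not_isSquare_p_mul {p : ℕ} [Fact p.Prime] {u : ℚ_[p]} (hu : ‖u‖ = 1) :
    ¬ IsSquare ((p : ℚ_[p]) * u) := by
  rintro ⟨r, hr⟩
  have hp := (Fact.out : p.Prime)
  have hr0 : r ≠ 0 := by
    rintro rfl
    rw [mul_zero] at hr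
    have hu0 : u ≠ 0 := norm_ne_zero_iff.1 (by rw [hu]; exact one_ne_zero)
    exact mul_ne_zero (by exact_mod_cast hp.ne_zero) hu0 hr
  have hn := congrArg norm hr
  rw [norm_mul, norm_mul, hu, Padic.norm_p, Padic.norm_eq_zpow_neg_valuation hr0, mul_one,
    ← zpow_add₀ (by exact_mod_cast hp.ne_zero), ← zpow_neg_one] at hn
  have h := zpow_right_injective₀ (by exact_mod_cast hp.pos) (by exact_mod_cast hp.one_lt.ne') hn
  omega

/-- A `p`-adic integer whose square root exists in `ℚ_p` is a square modulo `p`. -/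
theorem PadicInt.isSquare_toZMod {p : ℕ} [Fact p.Prime] {a : ℤ_[p]}
    (h : IsSquare (a : ℚ_[p])) : IsSquare (PadicInt.toZMod a) := by
  obtain ⟨r, hr⟩ := h
  have hle : ‖r‖ ≤ 1 := by
    have h := a.2
    rw [hr, norm_mul] at h
    nlinarith [norm_nonneg r]
  let s : ℤ_[p] := ⟨r, hle⟩
  have ha : a = s * s := Subtype.ext hr
  rw [ha, map_mul]
  exact ⟨_, rfl⟩

/-- Over `K = ℚ_p(z)` with `z' = 1`, with `a ∈ ℤ_p` a unit whose image in
`𝔽_p` is not a square, the fields `L₁ = K(√z)`, `L₂ = K(√(pz))`, `L₃ = K(√(az))`,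
`L₄ = K(√(paz))` are pairwise non-isomorphic p-adic Picard--Vessiot fields for
`y' = (1/(2z)) y` over `K`. -/
theorem four_nonisomorphic_padic_picard_vessiot_fields
    (p : ℕ) [hp : Fact p.Prime]
    (a : ℤ_[p]) (ha : IsUnit a) (hasq : ¬ IsSquare (PadicInt.toZMod a))
    (dK : FieldDeriv (RatFunc ℚ_[p]))
    (hdC : ∀ c : ℚ_[p], dK.d (algebraMap ℚ_[p] (RatFunc ℚ_[p]) c) = 0)
    (hdX : dK.d RatFunc.X = 1)
    (L₁ L₂ L₃ L₄ : Type) [Field L₁] [Field L₂] [Field L₃] [Field L₄]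
    [Algebra (RatFunc ℚ_[p]) L₁] [Algebra (RatFunc ℚ_[p]) L₂]
    [Algebra (RatFunc ℚ_[p]) L₃] [Algebra (RatFunc ℚ_[p]) L₄]
    (t₁ : L₁) (t₂ : L₂) (t₃ : L₃) (t₄ : L₄)
    (ht₁ : t₁ ^ 2 = algebraMap (RatFunc ℚ_[p]) L₁ RatFunc.X)
    (ht₂ : t₂ ^ 2 = algebraMap (RatFunc ℚ_[p]) L₂ ((p : RatFunc ℚ_[p]) * RatFunc.X))
    (ht₃ : t₃ ^ 2 = algebraMap (RatFunc ℚ_[p]) L₃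
      (algebraMap ℚ_[p] (RatFunc ℚ_[p]) (a : ℚ_[p]) * RatFunc.X))
    (ht₄ : t₄ ^ 2 = algebraMap (RatFunc ℚ_[p]) L₄
      ((p : RatFunc ℚ_[p]) * algebraMap ℚ_[p] (RatFunc ℚ_[p]) (a : ℚ_[p]) * RatFunc.X))
    (hgen₁ : IntermediateField.adjoin (RatFunc ℚ_[p]) ({t₁} : Set L₁) = ⊤)
    (hgen₂ : IntermediateField.adjoin (RatFunc ℚ_[p]) ({t₂} : Set L₂) = ⊤)
    (hgen₃ : IntermediateField.adjoin (RatFunc ℚ_[p]) ({t₃} : Set L₃) = ⊤)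
    (hgen₄ : IntermediateField.adjoin (RatFunc ℚ_[p]) ({t₄} : Set L₄) = ⊤)
    (d₁ : FieldDeriv L₁) (d₂ : FieldDeriv L₂) (d₃ : FieldDeriv L₃) (d₄ : FieldDeriv L₄)
    (hd₁ : ∀ x : RatFunc ℚ_[p], d₁.d (algebraMap (RatFunc ℚ_[p]) L₁ x)
      = algebraMap (RatFunc ℚ_[p]) L₁ (dK.d x))
    (hd₂ : ∀ x : RatFunc ℚ_[p], d₂.d (algebraMap (RatFunc ℚ_[p]) L₂ x)
      = algebraMap (RatFunc ℚ_[p]) L₂ (dK.d x))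
    (hd₃ : ∀ x : RatFunc ℚ_[p], d₃.d (algebraMap (RatFunc ℚ_[p]) L₃ x)
      = algebraMap (RatFunc ℚ_[p]) L₃ (dK.d x))
    (hd₄ : ∀ x : RatFunc ℚ_[p], d₄.d (algebraMap (RatFunc ℚ_[p]) L₄ x)
      = algebraMap (RatFunc ℚ_[p]) L₄ (dK.d x)) :
    (IsPicardVessiot dK d₁
        (Matrix.of fun _ _ : Fin 1 => (2 * RatFunc.X : RatFunc ℚ_[p])⁻¹) ∧
      IsPAdicField p L₁) ∧
    (IsPicardVessiot dK d₂
        (Matrix.of fun _ _ : Fin 1 => (2 * RatFunc.X : RatFunc ℚ_[p])⁻¹) ∧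
      IsPAdicField p L₂) ∧
    (IsPicardVessiot dK d₃
        (Matrix.of fun _ _ : Fin 1 => (2 * RatFunc.X : RatFunc ℚ_[p])⁻¹) ∧
      IsPAdicField p L₃) ∧
    (IsPicardVessiot dK d₄
        (Matrix.of fun _ _ : Fin 1 => (2 * RatFunc.X : RatFunc ℚ_[p])⁻¹) ∧
      IsPAdicField p L₄) ∧
    NoDiffIso (RatFunc ℚ_[p]) L₁ L₂ d₁ d₂ ∧
    NoDiffIso (RatFunc ℚ_[p]) L₁ L₃ d₁ d₃ ∧
    NoDiffIso (RatFunc ℚ_[p]) L₁ L₄ d₁ d₄ ∧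
    NoDiffIso (RatFunc ℚ_[p]) L₂ L₃ d₂ d₃ ∧
    NoDiffIso (RatFunc ℚ_[p]) L₂ L₄ d₂ d₄ ∧
    NoDiffIso (RatFunc ℚ_[p]) L₃ L₄ d₃ d₄ := by
  rw [RatFunc.algebraMap_eq_C] at ht₃ ht₄
  rw [← map_natCast (RatFunc.C (K := ℚ_[p]))] at ht₂ ht₄
  rw [← map_mul RatFunc.C] at ht₄
  rw [← one_mul (RatFunc.X : RatFunc ℚ_[p]), ← map_one (RatFunc.C (K := ℚ_[p]))] at ht₁
  have hp0 : (p : ℚ_[p]) ≠ 0 := by exact_mod_cast hp.out.ne_zero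
  have hna : ‖(a : ℚ_[p])‖ = 1 := PadicInt.isUnit_iff.1 ha
  have ha0 : (a : ℚ_[p]) ≠ 0 := norm_ne_zero_iff.1 (by rw [hna]; exact one_ne_zero)
  have hpa0 := mul_ne_zero hp0 ha0
  have hsa : ¬ IsSquare (a : ℚ_[p]) := fun h => hasq (PadicInt.isSquare_toZMod h)
  have hsp : ¬ IsSquare (p : ℚ_[p]) := by
    simpa using Padic.not_isSquare_p_mul (p := p) (u := 1) norm_one
  have hspa : ¬ IsSquare ((p : ℚ_[p]) * a) := Padic.not_isSquare_p_mul hna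
  refine ⟨⟨isPicardVessiot_of_sq one_ne_zero ht₁ hgen₁ hdC hdX hd₁,
      isPAdicField_of_sq one_ne_zero ht₁ hgen₁⟩,
    ⟨isPicardVessiot_of_sq hp0 ht₂ hgen₂ hdC hdX hd₂, isPAdicField_of_sq hp0 ht₂ hgen₂⟩,
    ⟨isPicardVessiot_of_sq ha0 ht₃ hgen₃ hdC hdX hd₃, isPAdicField_of_sq ha0 ht₃ hgen₃⟩,
    ⟨isPicardVessiot_of_sq hpa0 ht₄ hgen₄ hdC hdX hd₄, isPAdicField_of_sq hpa0 ht₄ hgen₄⟩,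
    noDiffIso_of_not_isSquare hp0 ht₁ ht₂ hgen₂ (by rwa [one_mul]) _ _,
    noDiffIso_of_not_isSquare ha0 ht₁ ht₃ hgen₃ (by rwa [one_mul]) _ _,
    noDiffIso_of_not_isSquare hpa0 ht₁ ht₄ hgen₄ (by rwa [one_mul]) _ _,
    noDiffIso_of_not_isSquare ha0 ht₂ ht₃ hgen₃ hspa _ _,
    noDiffIso_of_not_isSquare hpa0 ht₂ ht₄ hgen₄ ?_ _ _,
    noDiffIso_of_not_isSquare hpa0 ht₃ ht₄ hgen₄ ?_ _ _⟩
  · rintro ⟨r, hr⟩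
    refine hsa ⟨r / p, ?_⟩
    rw [div_mul_div_comm, ← hr]
    field_simp
  · rw [mul_left_comm]
    exact Padic.not_isSquare_p_mul (by rw [norm_mul, hna, one_mul])
end
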